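/- arXiv:1109.4616 — 9 statements merged into one kernel-verified Lean document; each statement's English description precedes it below -/
import Mathlib

section
/- Let A(Y) = a_p·Y^p + a_1·Y ∈ κ[Y] with a_p ≠ 0 and a_1 ≠ 0, and assume every root of A (in an algebraic closure of κ) lies in κ. Let B(Y) = b_p·Y^p + b_1·Y ∈ κ[Y]. Then B(κ) ⊆ A(κ) if and only if b_p = a_p·(b_1/a_1)^p, and in this case B(Y) = A((b_1/a_1)·Y) as polynomials. -/
open Polynomial

/-- Let `A(Y) = a_p·Y^p + a_1·Y ∈ κ[Y]` with `a_p ≠ 0`, `a_1 ≠ 0`, all of whose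
roots (in an algebraic closure of `κ`) lie in `κ`, and let `B(Y) = b_p·Y^p + b_1·Y`.  Then
`B(κ) ⊆ A(κ)` iff `b_p = a_p·(b_1/a_1)^p`, and in this case `B(Y) = A((b_1/a_1)·Y)`. -/
theorem stmt0 (p : ℕ) [Fact (Nat.Prime p)] (κ : Type) [Field κ] [Finite κ] [CharP κ p]
    (a_p a_1 b_p b_1 : κ) (hap : a_p ≠ 0) (ha1 : a_1 ≠ 0)
    (hroots : ∀ x : AlgebraicClosure κ, aeval x (C a_p * X ^ p + C a_1 * X) = 0 →
      ∃ y : κ, algebraMap κ (AlgebraicClosure κ) y = x) :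
    (((Set.range fun y : κ => eval y (C b_p * X ^ p + C b_1 * X)) ⊆
        Set.range fun y : κ => eval y (C a_p * X ^ p + C a_1 * X)) ↔
      b_p = a_p * (b_1 / a_1) ^ p) ∧
    (b_p = a_p * (b_1 / a_1) ^ p →
      C b_p * X ^ p + C b_1 * X = (C a_p * X ^ p + C a_1 * X).comp (C (b_1 / a_1) * X)) := by
  have hp : p.Prime := Fact.out
  have hcomp (h : b_p = a_p * (b_1 / a_1) ^ p) :
      C b_p * X ^ p + C b_1 * X = (C a_p * X ^ p + C a_1 * X).comp (C (b_1 / a_1) * X) := by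
    have hb1 : b_1 = a_1 * (b_1 / a_1) := by field_simp
    simp only [add_comp, mul_comp, C_comp, X_comp, pow_comp, mul_pow, ← mul_assoc, ← C_pow, ← C_mul]
    rw [← h, ← hb1]
  refine ⟨⟨fun hsub => ?_, fun h => ?_⟩, hcomp⟩
  · obtain ⟨r, hr0, hr⟩ : ∃ r : κ, r ≠ 0 ∧ a_p * r ^ p + a_1 * r = 0 := by
      obtain ⟨x, hx⟩ := IsAlgClosed.exists_pow_nat_eq
        (algebraMap κ (AlgebraicClosure κ) (-a_1 / a_p)) (Nat.sub_pos_of_lt hp.one_lt)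
      have hxp : x ^ p = algebraMap κ (AlgebraicClosure κ) (-a_1 / a_p) * x := by
        rw [← hx, pow_sub_one_mul hp.ne_zero]
      obtain ⟨y, rfl⟩ := hroots x (by
        simp only [map_add, map_mul, aeval_C, map_pow, aeval_X, hxp]
        rw [← mul_assoc, ← map_mul, mul_div_cancel₀ _ hap, map_neg]
        ring)
      rw [← map_pow, ← map_mul] at hxp
      have hy := (algebraMap κ (AlgebraicClosure κ)).injective hxp
      refine ⟨y, ?_, ?_⟩
      · rintro rfl
        rw [map_zero, zero_pow (Nat.sub_pos_of_lt hp.one_lt).ne', eq_comm, map_eq_zero] at hx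
        exact div_ne_zero (neg_ne_zero.mpr ha1) hap hx
      · rw [hy]
        field_simp
        ring
    by_contra hne
    have hd : b_p - a_p * (b_1 / a_1) ^ p ≠ 0 := sub_ne_zero.mpr hne
    -- If the two coefficients differed, the additive map `A` would be onto, hence injective.
    have hsurj : Function.Surjective fun y : κ => a_p * y ^ p + a_1 * y := by
      intro z
      obtain ⟨y, hy⟩ := (bijective_frobenius κ p).2 (z / (b_p - a_p * (b_1 / a_1) ^ p))
      rw [frobenius_def, eq_div_iff hd] at hy
      obtain ⟨w, hw⟩ := hsub ⟨y, rfl⟩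
      simp only [eval_add, eval_mul, eval_C, eval_pow, eval_X] at hw
      refine ⟨w - b_1 / a_1 * y, ?_⟩
      have hb1 : a_1 * (b_1 / a_1) = b_1 := by field_simp
      simp only [sub_pow_char, mul_pow]
      linear_combination hw + hy - y * hb1
    refine hr0 (Finite.injective_iff_surjective.mpr hsurj ?_)
    simp [hr, hp.ne_zero]
  · rintro _ ⟨y, rfl⟩
    refine ⟨b_1 / a_1 * y, ?_⟩
    simp only [hcomp h, eval_comp, eval_mul, eval_C, eval_X]
end

section
/- Let A(Y) = a_p·Y^p + a_1·Y ∈ κ[Y] with a_p ≠ 0 and a_1 ≠ 0, and assume every root of A (in an algebraic closure of κ) lies in κ. Let C(Y) = c_{p²}·Y^{p²} + c_p·Y^p + c_1·Y ∈ κ[Y]. Then C(κ) ⊆ A(κ) if and only if c_p = a_p·(c_1/a_1)^p + a_1·(c_{p²}/a_p)^{1/p}; and in this case C(Y) = A(β·Y^p + (c_1/a_1)·Y) where β = (c_{p²}/a_p)^{1/p}, which also equals c_p/a_1 − (a_p/a_1)·(c_1/a_1)^p. -/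
open Polynomial

/-- A binomial `a X ^ p + b X` with all its roots in the finite field `κ` is not surjective
on `κ`, since it has a nonzero root. -/
theorem not_surjective_of_roots_mem (p : ℕ) [Fact (Nat.Prime p)] (κ : Type) [Field κ] [Finite κ]
    (a b : κ) (ha : a ≠ 0) (hb : b ≠ 0)
    (hroots : ∀ x : AlgebraicClosure κ, aeval x (C a * X ^ p + C b * X) = 0 →
      ∃ y : κ, algebraMap κ (AlgebraicClosure κ) y = x) :
    ¬ Function.Surjective fun y : κ => a * y ^ p + b * y := by
  intro hsurj
  have hp : 1 < p := (Fact.out : Nat.Prime p).one_lt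
  have ha' : algebraMap κ (AlgebraicClosure κ) a ≠ 0 := by simpa using ha
  have hb' : algebraMap κ (AlgebraicClosure κ) b ≠ 0 := by simpa using hb
  obtain ⟨x, hx⟩ := IsAlgClosed.exists_pow_nat_eq
    (-(algebraMap κ (AlgebraicClosure κ) b / algebraMap κ (AlgebraicClosure κ) a))
    (Nat.sub_pos_of_lt hp)
  have hx0 : x ≠ 0 := by
    rintro rfl
    rw [zero_pow (Nat.sub_pos_of_lt hp).ne'] at hx
    exact neg_ne_zero.mpr (div_ne_zero hb' ha') hx.symm
  have hpow : x ^ p = x ^ (p - 1) * x := by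
    rw [← pow_succ, Nat.sub_add_cancel hp.le]
  have hroot : algebraMap κ (AlgebraicClosure κ) a * x ^ p +
      algebraMap κ (AlgebraicClosure κ) b * x = 0 := by
    rw [hpow, hx]
    field_simp
    ring
  obtain ⟨y, rfl⟩ := hroots x (by simpa using hroot)
  have hy : a * y ^ p + b * y = 0 := by
    apply (algebraMap κ (AlgebraicClosure κ)).injective
    simpa using hroot
  have hy0 : y = 0 := Finite.injective_iff_surjective.mpr hsurj (by
    simpa [(zero_lt_one.trans hp).ne'] using hy)
  exact hx0 (by simp [hy0])

/-- Composition of the additive polynomials `a X ^ p + b X` and `β X ^ p + γ X`. -/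
theorem additive_comp (p : ℕ) [Fact (Nat.Prime p)] (κ : Type) [Field κ] [CharP κ p]
    (a b β γ : κ) :
    (C a * X ^ p + C b * X).comp (C β * X ^ p + C γ * X) =
      C (a * β ^ p) * X ^ (p ^ 2) + C (a * γ ^ p + b * β) * X ^ p + C (b * γ) * X := by
  simp only [add_comp, mul_comp, C_comp, pow_comp, X_comp, add_pow_char, mul_pow, C_add, C_mul,
    C_pow, ← pow_mul, pow_two p]
  ring

/-- With `A(Y) = a_p·Y^p + a_1·Y` as before (nonzero coefficients, all roots in
`κ`) and `C(Y) = c_{p²}·Y^{p²} + c_p·Y^p + c_1·Y`, one has `C(κ) ⊆ A(κ)` iff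
`c_p = a_p·(c_1/a_1)^p + a_1·(c_{p²}/a_p)^{1/p}`, and in this case `C(Y) = A(β·Y^p + (c_1/a_1)·Y)`
where `β = (c_{p²}/a_p)^{1/p} = c_p/a_1 − (a_p/a_1)·(c_1/a_1)^p`. -/
theorem stmt1 (p : ℕ) [Fact (Nat.Prime p)] (κ : Type) [Field κ] [Finite κ] [CharP κ p]
    (a_p a_1 c_p2 c_p c_1 : κ) (hap : a_p ≠ 0) (ha1 : a_1 ≠ 0)
    (hroots : ∀ x : AlgebraicClosure κ, aeval x (C a_p * X ^ p + C a_1 * X) = 0 →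
      ∃ y : κ, algebraMap κ (AlgebraicClosure κ) y = x) :
    (((Set.range fun y : κ => eval y (C c_p2 * X ^ (p ^ 2) + C c_p * X ^ p + C c_1 * X)) ⊆
        Set.range fun y : κ => eval y (C a_p * X ^ p + C a_1 * X)) ↔
      c_p = a_p * (c_1 / a_1) ^ p + a_1 * (frobeniusEquiv κ p).symm (c_p2 / a_p)) ∧
    (c_p = a_p * (c_1 / a_1) ^ p + a_1 * (frobeniusEquiv κ p).symm (c_p2 / a_p) →
      (C c_p2 * X ^ (p ^ 2) + C c_p * X ^ p + C c_1 * X =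
          (C a_p * X ^ p + C a_1 * X).comp
            (C ((frobeniusEquiv κ p).symm (c_p2 / a_p)) * X ^ p + C (c_1 / a_1) * X) ∧
        (frobeniusEquiv κ p).symm (c_p2 / a_p) = c_p / a_1 - a_p / a_1 * (c_1 / a_1) ^ p)) := by
  set β := (frobeniusEquiv κ p).symm (c_p2 / a_p) with hβ
  have hβp : a_p * β ^ p = c_p2 := by
    rw [hβ, frobeniusEquiv_symm_pow_p]
    field_simp
  have hγ : a_1 * (c_1 / a_1) = c_1 := by field_simp
  have hcomp := additive_comp p κ a_p a_1 β (c_1 / a_1)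
  rw [hβp, hγ] at hcomp
  refine ⟨⟨fun h => ?_, fun h => ?_⟩, fun h => ⟨?_, ?_⟩⟩
  · by_contra hne
    apply not_surjective_of_roots_mem p κ a_p a_1 hap ha1 hroots
    intro w
    set e := c_p - (a_p * (c_1 / a_1) ^ p + a_1 * β) with he
    have he0 : e ≠ 0 := sub_ne_zero.mpr hne
    set y := (frobeniusEquiv κ p).symm (w / e) with hy
    have hyp : e * y ^ p = w := by
      rw [hy, frobeniusEquiv_symm_pow_p]
      field_simp
    obtain ⟨z, hz⟩ := h ⟨y, rfl⟩
    have hcy := congrArg (eval y) hcomp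
    simp only [eval_comp, eval_add, eval_mul, eval_C, eval_pow, eval_X] at hz hcy
    refine ⟨z - (β * y ^ p + c_1 / a_1 * y), ?_⟩
    simp only [sub_pow_char]
    rw [← hyp, he]
    linear_combination hz - hcy
  · rw [← h] at hcomp
    rintro _ ⟨y, rfl⟩
    refine ⟨eval y (C β * X ^ p + C (c_1 / a_1) * X), ?_⟩
    simp only [← hcomp, eval_comp]
  · rw [hcomp, ← h]
  · rw [h]
    field_simp
    ring
end

section
/- Let A(Y) = a_p·Y^p + a_1·Y ∈ κ[Y] with a_p ≠ 0 and a_1 ≠ 0, and assume every root of A (in an algebraic closure of κ) lies in κ. Let D(Y) = d_{p³}·Y^{p³} + d_{p²}·Y^{p²} + d_p·Y^p + d_1·Y ∈ κ[Y]. Then D(κ) ⊆ A(κ) if and only if (a_1/a_p)·(d_{p³}/a_p)^{1/p} + (d_p/a_1)^p = d_{p²}/a_p + (a_p/a_1)^p·(d_1/a_1)^{p²}. -/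
open Polynomial

/-- The image of the Artin–Schreier map `z ↦ z ^ p - z`, as an additive subgroup. -/
def artinSchreierRange (k : Type*) [CommRing k] (p : ℕ) [ExpChar k p] : AddSubgroup k :=
  ((frobenius k p).toAddMonoidHom - AddMonoidHom.id k).range

theorem mem_artinSchreierRange {k : Type*} [CommRing k] {p : ℕ} [ExpChar k p] {x : k} :
    x ∈ artinSchreierRange k p ↔ ∃ z : k, z ^ p - z = x := by
  simp [artinSchreierRange, AddMonoidHom.mem_range, frobenius_def]

theorem artinSchreierRange_ne_top (k : Type*) [Field k] [Finite k] (p : ℕ) [ExpChar k p]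
    (hp : p ≠ 0) : artinSchreierRange k p ≠ ⊤ := by
  intro h
  have hsurj : Function.Surjective fun z : k => z ^ p - z := fun x =>
    mem_artinSchreierRange.1 (h ▸ AddSubgroup.mem_top x)
  have hinj := Finite.injective_iff_surjective.2 hsurj
  exact zero_ne_one (hinj (show (0 : k) ^ p - 0 = 1 ^ p - 1 by simp [hp]))

/-- A `p`-polynomial of degree at most `p ^ 3` is congruent to a monomial in `y ^ p ^ 2` modulo the
image of the Artin–Schreier map. -/
theorem additive_eval_mem_artinSchreierRange_iff {k : Type*} [CommRing k] {p : ℕ} [ExpChar k p]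
    (f e₂ e₁ e₀ y : k) :
    f ^ p * y ^ p ^ 3 + e₂ * y ^ p ^ 2 + e₁ * y ^ p + e₀ * y ∈ artinSchreierRange k p ↔
      (f + e₂ + e₁ ^ p + e₀ ^ p ^ 2) * y ^ p ^ 2 ∈ artinSchreierRange k p := by
  have key (x : k) : x ^ p - x ∈ artinSchreierRange k p := mem_artinSchreierRange.2 ⟨x, rfl⟩
  have h := sub_mem (sub_mem (sub_mem (key (f * y ^ p ^ 2)) (key (e₁ * y ^ p))) (key (e₀ * y)))
    (key ((e₀ * y) ^ p))
  rw [← sub_add_cancel (f ^ p * y ^ p ^ 3 + e₂ * y ^ p ^ 2 + e₁ * y ^ p + e₀ * y)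
    ((f + e₂ + e₁ ^ p + e₀ ^ p ^ 2) * y ^ p ^ 2)]
  refine AddSubgroup.add_mem_cancel_left _ ?_
  convert h using 1
  ring

theorem forall_mul_pow_mem_artinSchreierRange_iff {k : Type*} [Field k] [Finite k] {p : ℕ}
    [Fact p.Prime] [CharP k p] (s : k) :
    (∀ y : k, s * y ^ p ^ 2 ∈ artinSchreierRange k p) ↔ s = 0 := by
  refine ⟨fun h => by_contra fun hs => ?_, fun h y => by simp [h, zero_mem]⟩
  refine artinSchreierRange_ne_top k p (Fact.out : p.Prime).ne_zero (eq_top_iff.2 fun x _ => ?_)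
  obtain ⟨y, hy⟩ := (iterateFrobeniusEquiv k p 2).surjective (x / s)
  rw [iterateFrobeniusEquiv_def] at hy
  have := h y
  rwa [hy, mul_div_cancel₀ _ hs] at this

/-- If all roots of `a * Y ^ p + b * Y` are rational, then `-b / a` is a `(p - 1)`-st power. -/
theorem exists_pow_mul_eq_neg_of_roots {k : Type*} [Field k] {p : ℕ} (hp : 1 < p) {a b : k}
    (ha : a ≠ 0) (hb : b ≠ 0)
    (hroots : ∀ x : AlgebraicClosure k, aeval x (C a * X ^ p + C b * X) = 0 →
      ∃ y : k, algebraMap k (AlgebraicClosure k) y = x) :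
    ∃ c : k, c ≠ 0 ∧ a * c ^ p = -b * c := by
  obtain ⟨x, hx⟩ := IsAlgClosed.exists_pow_nat_eq
    (algebraMap k (AlgebraicClosure k) (-b / a)) (Nat.sub_pos_of_lt hp)
  have hxp : algebraMap k (AlgebraicClosure k) a * x ^ p =
      -algebraMap k (AlgebraicClosure k) b * x := by
    have ha' : algebraMap k (AlgebraicClosure k) a ≠ 0 := by simpa using ha
    rw [← Nat.sub_add_cancel hp.le, pow_succ, hx]
    simp only [map_div₀, map_neg]
    field_simp
  obtain ⟨c, rfl⟩ := hroots x (by simp [hxp])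
  refine ⟨c, ?_, ?_⟩
  · rintro rfl
    rw [map_zero, zero_pow (Nat.sub_pos_of_lt hp).ne', eq_comm, map_eq_zero] at hx
    exact div_ne_zero (neg_ne_zero.2 hb) ha hx
  · apply (algebraMap k (AlgebraicClosure k)).injective
    simpa using hxp

/-- With `A(Y) = a_p·Y^p + a_1·Y` as before (nonzero coefficients, all roots in
`κ`) and `D(Y) = d_{p³}·Y^{p³} + d_{p²}·Y^{p²} + d_p·Y^p + d_1·Y`, one has `D(κ) ⊆ A(κ)` iff
`(a_1/a_p)·(d_{p³}/a_p)^{1/p} + (d_p/a_1)^p = d_{p²}/a_p + (a_p/a_1)^p·(d_1/a_1)^{p²}`. -/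
theorem stmt2 (p : ℕ) [Fact (Nat.Prime p)] (κ : Type) [Field κ] [Finite κ] [CharP κ p]
    (a_p a_1 d_p3 d_p2 d_p d_1 : κ) (hap : a_p ≠ 0) (ha1 : a_1 ≠ 0)
    (hroots : ∀ x : AlgebraicClosure κ, aeval x (C a_p * X ^ p + C a_1 * X) = 0 →
      ∃ y : κ, algebraMap κ (AlgebraicClosure κ) y = x) :
    ((Set.range fun y : κ =>
        eval y (C d_p3 * X ^ (p ^ 3) + C d_p2 * X ^ (p ^ 2) + C d_p * X ^ p + C d_1 * X)) ⊆
        Set.range fun y : κ => eval y (C a_p * X ^ p + C a_1 * X)) ↔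
      a_1 / a_p * (frobeniusEquiv κ p).symm (d_p3 / a_p) + (d_p / a_1) ^ p =
        d_p2 / a_p + (a_p / a_1) ^ p * (d_1 / a_1) ^ (p ^ 2) := by
  have hp := (Fact.out : p.Prime)
  obtain ⟨c, hc, hac⟩ := exists_pow_mul_eq_neg_of_roots hp.one_lt hap ha1 hroots
  obtain ⟨f, hf⟩ : ∃ f, (frobeniusEquiv κ p).symm (d_p3 / a_p) = f := ⟨_, rfl⟩
  have hfp : d_p3 = a_p * f ^ p := by
    have : f ^ p = d_p3 / a_p := by rw [← hf, frobeniusEquiv_symm_pow_p]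
    rw [this, mul_div_cancel₀ _ hap]
  have hbc : -a_1 * c ≠ 0 := mul_ne_zero (neg_ne_zero.2 ha1) hc
  have hrange (x : κ) : (x ∈ Set.range fun y : κ => eval y (C a_p * X ^ p + C a_1 * X)) ↔
      x / (-a_1 * c) ∈ artinSchreierRange κ p := by
    rw [mem_artinSchreierRange, Set.mem_range, (Equiv.mulLeft₀ c hc).surjective.exists]
    simp only [eval_add, eval_mul, eval_C, eval_pow, eval_X, Equiv.mulLeft₀_apply,
      eq_div_iff hbc]
    refine exists_congr fun z => ?_
    rw [mul_pow, ← mul_assoc, hac]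
    ring_nf
  have hdiv (y : κ) : eval y (C d_p3 * X ^ (p ^ 3) + C d_p2 * X ^ (p ^ 2) + C d_p * X ^ p +
      C d_1 * X) / (-a_1 * c) = (f / c) ^ p * y ^ p ^ 3 + d_p2 / (-a_1 * c) * y ^ p ^ 2 +
      d_p / (-a_1 * c) * y ^ p + d_1 / (-a_1 * c) * y := by
    have : d_p3 / (-a_1 * c) = (f / c) ^ p := by
      rw [hfp, ← hac, mul_div_mul_left _ _ hap, div_pow]
    simp only [eval_add, eval_mul, eval_C, eval_pow, eval_X, ← this]
    ring
  simp only [Set.range_subset_iff, hrange, hdiv, additive_eval_mem_artinSchreierRange_iff,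
    forall_mul_pow_mem_artinSchreierRange_iff, hf]
  have hneg : (-1 : κ) ^ p = -1 := neg_one_pow_char κ p
  have h₁ (d : κ) : (d / (-a_1 * c)) ^ p = -(d / a_1) ^ p / c ^ p := by
    rw [show d / (-a_1 * c) = -1 * (d / a_1 / c) by field_simp, mul_pow, hneg, div_pow (d / a_1)]
    ring
  have hcp : c ^ p = -(a_1 / a_p) * c := by field_simp; linear_combination hac
  have hcpp : (c ^ p) ^ p = -(a_1 / a_p) ^ p * c ^ p := by
    rw [hcp, mul_pow, neg_pow, hneg, ← hcp]; ring
  have h₂ : (d_1 / (-a_1 * c)) ^ p ^ 2 =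
      (a_p / a_1) ^ p * (d_1 / a_1) ^ p ^ 2 / c ^ p := by
    rw [sq, pow_mul, h₁, div_pow, hcpp, neg_pow, hneg, ← pow_mul, div_pow a_p, div_pow a_1]
    field_simp
  have hcp0 : c ^ p ≠ 0 := pow_ne_zero _ hc
  have hfc : f / c = -(a_1 / a_p * f) / c ^ p := by
    rw [hcp]
    field_simp
  have hsum : f / c + d_p2 / (-a_1 * c) + (d_p / (-a_1 * c)) ^ p + (d_1 / (-a_1 * c)) ^ p ^ 2 =
      (d_p2 / a_p + (a_p / a_1) ^ p * (d_1 / a_1) ^ p ^ 2 -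
        (a_1 / a_p * f + (d_p / a_1) ^ p)) / c ^ p := by
    rw [h₁, h₂, hfc, ← hac, ← div_div d_p2]
    ring
  rw [hsum, div_eq_zero_iff, or_iff_left hcp0, sub_eq_zero, eq_comm]
end

section
/- Let A(Y) = Y^{p²} + a·Y^p + b·Y ∈ κ[Y] with b ≠ 0 (so A is separable). Then the degree of the splitting field of A over κ is a power of p (equivalently, equals 1 or p) if and only if A has a root in κ^× and b is a (p−1)-th power of an element of κ^×. -/
open Polynomial

theorem natDegree_X_pow_sq_add {p : ℕ} [Fact p.Prime] {K : Type*} [Field K] (a b : K) :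
    (X ^ p ^ 2 + C a * X ^ p + C b * X : K[X]).natDegree = p ^ 2 := by
  have h1 := (Fact.out : p.Prime).one_lt
  have h2 : p < p ^ 2 := by nlinarith
  rw [add_assoc, natDegree_add_eq_left_of_natDegree_lt, natDegree_X_pow]
  rw [natDegree_X_pow]
  refine (natDegree_add_le _ _).trans_lt (max_lt ?_ ?_)
  · exact (natDegree_C_mul_X_pow_le a p).trans_lt h2
  · exact (natDegree_C_mul_le _ _).trans_lt (by rw [natDegree_X]; omega)

theorem separable_X_pow_sq_add {p : ℕ} {K : Type*} [Field K] [CharP K p] (a : K) {b : K}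
    (hb : b ≠ 0) :
    (X ^ p ^ 2 + C a * X ^ p + C b * X : K[X]).Separable := by
  have hd : derivative (X ^ p ^ 2 + C a * X ^ p + C b * X : K[X]) = C b := by
    simp [derivative_X_pow]
  rw [separable_def, hd]
  exact isCoprime_one_right.of_isCoprime_of_dvd_right
    (isUnit_C.2 (isUnit_iff_ne_zero.2 hb)).dvd

theorem aeval_X_pow_sq_add {p : ℕ} {κ L : Type*} [Field κ] [Field L] [Algebra κ L] (a b : κ)
    (y : L) :
    aeval y (X ^ p ^ 2 + C a * X ^ p + C b * X : κ[X]) =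
      y ^ p ^ 2 + algebraMap κ L a * y ^ p + algebraMap κ L b * y := by
  simp

theorem exists_moore_det_ne_zero {p : ℕ} [Fact p.Prime] {K : Type*} [Field K] {S : Finset K}
    (hS : p < S.card) {x : K} (hx : x ≠ 0) :
    ∃ y ∈ S, x * y ^ p - x ^ p * y ≠ 0 := by
  have h1 := (Fact.out : p.Prime).one_lt
  by_contra! h
  have hdeg : (C x * X ^ p - C (x ^ p) * X : K[X]).natDegree = p := by
    rw [natDegree_sub_eq_left_of_natDegree_lt, natDegree_C_mul_X_pow _ _ hx]
    rw [natDegree_C_mul_X_pow _ _ hx]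
    exact (natDegree_C_mul_le _ _).trans_lt (by rwa [natDegree_X])
  have hne : (C x * X ^ p - C (x ^ p) * X : K[X]) ≠ 0 := by
    intro h0
    rw [h0, natDegree_zero] at hdeg
    omega
  have := card_le_degree_of_subset_roots (p := (C x * X ^ p - C (x ^ p) * X : K[X])) (Z := S)
    fun y hy => (mem_roots hne).2 (by simpa using h y hy)
  omega

section CharP

variable {p : ℕ} [Fact p.Prime] {K : Type*} [Field K] [CharP K p]

theorem RingHom.map_eq_self_of_pow_char_eq_self (σ : K →+* K) {x : K} (hx : x ^ p = x) :
    σ x = x := by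
  have h : x ∈ (⊥ : Subfield K) := (Subfield.mem_bot_iff_pow_eq_self K p).2 hx
  exact (bot_le : ⊥ ≤ σ.eqLocusField (RingHom.id K)) h

/-- The Moore determinant of two roots of `Y^{p²} + a·Y^p + b·Y` is multiplied by `b` under
Frobenius. -/
theorem moore_det_pow_char {a b x y : K} (hx : x ^ p ^ 2 + a * x ^ p + b * x = 0)
    (hy : y ^ p ^ 2 + a * y ^ p + b * y = 0) :
    (x * y ^ p - x ^ p * y) ^ p = b * (x * y ^ p - x ^ p * y) := by
  rw [sub_pow_char, mul_pow, mul_pow, ← pow_mul, ← pow_mul, ← sq]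
  linear_combination x ^ p * hy - y ^ p * hx

end CharP

section Galois

variable {p : ℕ} [Fact p.Prime] {κ L : Type*} [Field κ] [CharP κ p] [Field L] [Algebra κ L]

theorem algEquiv_pow_char_eq_one {a c x : κ} (hx : x ≠ 0) (hc : c ≠ 0)
    (hxr : x ^ p ^ 2 + a * x ^ p + c ^ (p - 1) * x = 0)
    [IsSplittingField κ L (X ^ p ^ 2 + C a * X ^ p + C (c ^ (p - 1)) * X : κ[X])]
    (σ : L ≃ₐ[κ] L) : σ ^ p = 1 := by
  have : CharP L p := charP_of_injective_algebraMap (algebraMap κ L).injective p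
  have hp := (Fact.out : p.Prime)
  have hp1 : p - 1 + 1 = p := Nat.sub_add_cancel hp.one_le
  have hxL : algebraMap κ L x ≠ 0 := by simpa using hx
  have hcL : algebraMap κ L c ≠ 0 := by simpa using hc
  suffices h : ((σ ^ p : L ≃ₐ[κ] L) : L →ₐ[κ] L) = AlgHom.id κ L from
    AlgEquiv.ext fun y => DFunLike.congr_fun h y
  refine AlgHom.ext_of_adjoin_eq_top (IsSplittingField.adjoin_rootSet L
    (X ^ p ^ 2 + C a * X ^ p + C (c ^ (p - 1)) * X : κ[X])) fun y hy => ?_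
  have hyr := aeval_eq_zero_of_mem_rootSet hy
  rw [aeval_X_pow_sq_add] at hyr
  have hxr' := congrArg (algebraMap κ L) hxr
  simp only [map_add, map_mul, map_pow, map_zero] at hxr' hyr
  have hW := moore_det_pow_char hxr' hyr
  set x' := algebraMap κ L x
  set c' := algebraMap κ L c
  have hcp : c' ^ p = c' ^ (p - 1) * c' := by rw [← pow_succ, hp1]
  have hWfix : σ (x' * y ^ p - x' ^ p * y) = x' * y ^ p - x' ^ p * y := by
    have hq : ((x' * y ^ p - x' ^ p * y) / c') ^ p = (x' * y ^ p - x' ^ p * y) / c' := by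
      rw [div_pow, hW, hcp]
      field_simp
    have h := RingHom.map_eq_self_of_pow_char_eq_self (σ : L →+* L) hq
    have h' : σ ((x' * y ^ p - x' ^ p * y) / c') = (x' * y ^ p - x' ^ p * y) / c' := h
    rw [map_div₀, AlgEquiv.commutes] at h'
    exact (div_left_inj' hcL).1 h'
  have ht : ((σ y - y) / x') ^ p = (σ y - y) / x' := by
    rw [map_sub, map_mul, map_mul, map_pow, map_pow, AlgEquiv.commutes] at hWfix
    rw [div_pow, sub_pow_char, div_eq_div_iff (pow_ne_zero _ hxL) hxL]
    linear_combination hWfix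
  set t := (σ y - y) / x' with ht_def
  have hσt : σ t = t := RingHom.map_eq_self_of_pow_char_eq_self (σ : L →+* L) ht
  have hσy : σ y = y + t * x' := by rw [ht_def]; field_simp; ring
  have hpow : ∀ m : ℕ, (σ ^ m) y = y + m * (t * x') := by
    intro m
    induction m with
    | zero => simp
    | succ m ih =>
      rw [pow_succ', AlgEquiv.mul_apply, ih]
      simp only [map_add, map_mul, map_natCast, hσt, hσy, AlgEquiv.commutes, x']
      push_cast
      ring
  simpa using hpow p

theorem algEquiv_map_eq_self_of_pow_char_eq_mul (hG : IsPGroup p (L ≃ₐ[κ] L)) {b : κ} {w : L}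
    (hw : w ^ p = algebraMap κ L b * w) (σ : L ≃ₐ[κ] L) : σ w = w := by
  have : CharP L p := charP_of_injective_algebraMap (algebraMap κ L).injective p
  rcases eq_or_ne w 0 with rfl | hw0
  · simp
  have hbL : algebraMap κ L b ≠ 0 := by
    intro h
    rw [h, zero_mul] at hw
    exact hw0 (pow_eq_zero_iff (Fact.out : p.Prime).ne_zero |>.1 hw)
  have hz : (σ w / w) ^ p = σ w / w := by
    rw [div_pow, ← map_pow, hw, map_mul, AlgEquiv.commutes]
    field_simp
  set z := σ w / w with hz_def
  have hσz : σ z = z := RingHom.map_eq_self_of_pow_char_eq_self (σ : L →+* L) hz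
  have hσw : σ w = z * w := by rw [hz_def]; field_simp
  have hpow : ∀ m : ℕ, (σ ^ m) w = z ^ m * w := by
    intro m
    induction m with
    | zero => simp
    | succ m ih =>
      rw [pow_succ', AlgEquiv.mul_apply, ih, map_mul, map_pow, hσz, hσw]
      ring
  obtain ⟨k, hk⟩ := hG σ
  have hzk : z ^ p ^ k = z := by
    clear hk
    induction k with
    | zero => simp
    | succ k ih => rw [pow_succ, pow_mul, ih, hz]
  have h := hpow (p ^ k)
  rw [hk, hzk, AlgEquiv.one_apply] at h
  rw [hσw, ← h]

theorem exists_root_and_pow_of_isPGroup (a : κ) {b : κ} (hb : b ≠ 0)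
    [IsSplittingField κ L (X ^ p ^ 2 + C a * X ^ p + C b * X : κ[X])]
    (hG : IsPGroup p (L ≃ₐ[κ] L)) :
    (∃ x : κ, x ≠ 0 ∧ x ^ p ^ 2 + a * x ^ p + b * x = 0) ∧
      ∃ c : κ, c ≠ 0 ∧ c ^ (p - 1) = b := by
  classical
  have : CharP L p := charP_of_injective_algebraMap (algebraMap κ L).injective p
  have hp := (Fact.out : p.Prime)
  have hp1 : p - 1 + 1 = p := Nat.sub_add_cancel hp.one_le
  have hsep := separable_X_pow_sq_add (p := p) a hb
  have hcard := card_rootSet_eq_natDegree hsep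
    (IsSplittingField.splits L (X ^ p ^ 2 + C a * X ^ p + C b * X : κ[X]))
  rw [natDegree_X_pow_sq_add] at hcard
  have hmem : ∀ y : L, y ∈ (X ^ p ^ 2 + C a * X ^ p + C b * X : κ[X]).rootSet L ↔
      y ^ p ^ 2 + algebraMap κ L a * y ^ p + algebraMap κ L b * y = 0 := fun y => by
    rw [mem_rootSet_of_ne hsep.ne_zero, aeval_X_pow_sq_add]
  have : IsGalois κ L := IsGalois.of_separable_splitting_field hsep
  have : FiniteDimensional κ L := IsSplittingField.finiteDimensional L
    (X ^ p ^ 2 + C a * X ^ p + C b * X : κ[X])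
  have hdvd : p ∣ Nat.card ((X ^ p ^ 2 + C a * X ^ p + C b * X : κ[X]).rootSet L) := by
    rw [Nat.card_eq_fintype_card, hcard]
    exact dvd_pow_self p two_ne_zero
  have h0 : (0 : L) ∈ (X ^ p ^ 2 + C a * X ^ p + C b * X : κ[X]).rootSet L := by
    rw [hmem]; simp [hp.ne_zero]
  obtain ⟨⟨x, hx⟩, hfix, hx0⟩ := hG.exists_fixed_point_of_prime_dvd_card_of_fixed_point _ hdvd
    (a := ⟨0, h0⟩) fun σ => Subtype.ext (map_zero σ)
  have hx0 : x ≠ 0 := fun h => hx0 (Subtype.ext h.symm)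
  have hxfix : ∀ σ : L ≃ₐ[κ] L, σ x = x := fun σ => congrArg Subtype.val (hfix σ)
  rw [hmem] at hx
  obtain ⟨y, hy, hw0⟩ := exists_moore_det_ne_zero
    (S := ((X ^ p ^ 2 + C a * X ^ p + C b * X : κ[X]).rootSet L).toFinset) (p := p)
    (by rw [Set.toFinset_card, hcard]; nlinarith [hp.one_lt]) hx0
  rw [Set.mem_toFinset, hmem] at hy
  have hw := moore_det_pow_char hx hy
  obtain ⟨x₀, rfl⟩ := (IsGalois.mem_range_algebraMap_iff_fixed x).2 hxfix
  obtain ⟨c, hc⟩ := (IsGalois.mem_range_algebraMap_iff_fixed _).2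
    (algEquiv_map_eq_self_of_pow_char_eq_mul hG hw)
  have hinj := (algebraMap κ L).injective
  rw [← hc] at hw hw0
  refine ⟨⟨x₀, by simpa using hx0, hinj (by simpa using hx)⟩, c, by simpa using hw0, ?_⟩
  refine hinj (mul_right_cancel₀ hw0 ?_)
  rw [map_pow, ← pow_succ, hp1, hw]

end Galois

/-- Let `A(Y) = Y^{p²} + a·Y^p + b·Y ∈ κ[Y]` with `b ≠ 0`.  The degree of the
splitting field of `A` over `κ` is a power of `p` if and only if `A` has a root in `κ^×` and `b`
is a `(p−1)`-th power of an element of `κ^×`. -/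
theorem stmt3 (p : ℕ) [Fact (Nat.Prime p)] (κ : Type) [Field κ] [Finite κ] [CharP κ p]
    (a b : κ) (hb : b ≠ 0) :
    (∃ k : ℕ, Module.finrank κ (X ^ (p ^ 2) + C a * X ^ p + C b * X : κ[X]).SplittingField
        = p ^ k) ↔
      ((∃ x : κ, x ≠ 0 ∧ eval x (X ^ (p ^ 2) + C a * X ^ p + C b * X : κ[X]) = 0) ∧
        ∃ c : κ, c ≠ 0 ∧ c ^ (p - 1) = b) := by
  have hsep := separable_X_pow_sq_add (p := p) a hb
  have : IsGalois κ (X ^ (p ^ 2) + C a * X ^ p + C b * X : κ[X]).SplittingField :=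
    IsGalois.of_separable_splitting_field hsep
  rw [← IsGalois.card_aut_eq_finrank, ← IsPGroup.iff_card]
  simp only [eval_add, eval_mul, eval_pow, eval_X, eval_C]
  refine ⟨exists_root_and_pow_of_isPGroup a hb, ?_⟩
  rintro ⟨⟨x, hx, hxr⟩, c, hc, rfl⟩ σ
  exact ⟨1, by rw [pow_one]; exact algEquiv_pow_char_eq_one hx hc hxr σ⟩
end

section
/- Let p be a prime and ℓ ≥ 1 an integer with gcd(ℓ,p) = 1, and fix a primitive ℓ-th root of unity ζ_ℓ ∈ ℂ. Then for every tuple λ = (λ_1,…,λ_r) of positive integers, Σ_{pλ}(ℓ) = Σ_λ(ℓ), where pλ denotes the tuple (pλ_1,…,pλ_r). -/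
/-- Multiplication by `p`, coprime to `ℓ`, permutes the residues modulo `ℓ`. -/
theorem bijective_mul_mod_of_coprime {p ℓ : ℕ} (hℓ : 0 < ℓ) (hcop : Nat.Coprime ℓ p) :
    Function.Bijective (fun x : Fin ℓ => (⟨p * x % ℓ, Nat.mod_lt _ hℓ⟩ : Fin ℓ)) := by
  refine Finite.injective_iff_bijective.mp fun x y hxy => ?_
  have hmod : p * x ≡ p * y [MOD ℓ] := congrArg Fin.val hxy
  exact Fin.ext ((Nat.ModEq.cancel_left_of_coprime hcop hmod).eq_of_lt_of_lt x.2 y.2)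

/-- Let `p` be a prime, `ℓ ≥ 1` with `gcd(ℓ,p) = 1`, and `ζ` a primitive
`ℓ`-th root of unity in `ℂ`.  For every tuple `λ = (λ_1,…,λ_r)` of positive integers,
`Σ_{pλ}(ℓ) = Σ_λ(ℓ)`, where `Σ_λ(ℓ)` is the sum of `ζ^{ι_1λ_1+⋯+ι_rλ_r}` over all `r`-tuples of
pairwise distinct integers `0 ≤ ι_i ≤ ℓ−1`. -/
theorem stmt5 (p ℓ : ℕ) (hp : p.Prime) (hℓ : 1 ≤ ℓ) (hcop : Nat.Coprime ℓ p)
    (ζ : ℂ) (hζ : IsPrimitiveRoot ζ ℓ)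
    (r : ℕ) (lam : Fin r → ℕ) (hlam : ∀ i, 1 ≤ lam i) :
    (∑ ι ∈ Finset.univ.filter (fun ι : Fin r → Fin ℓ => Function.Injective ι),
        ζ ^ (∑ i, (ι i : ℕ) * (p * lam i))) =
      ∑ ι ∈ Finset.univ.filter (fun ι : Fin r → Fin ℓ => Function.Injective ι),
        ζ ^ (∑ i, (ι i : ℕ) * lam i) := by
  have hbij := bijective_mul_mod_of_coprime hℓ hcop
  refine Finset.sum_equiv ((Equiv.refl (Fin r)).arrowCongr (Equiv.ofBijective _ hbij)) ?_ ?_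
  · intro ι
    simp only [Finset.mem_filter, Finset.mem_univ, true_and]
    exact (hbij.injective.of_comp_iff ι).symm
  · intro ι _
    simp only [← Finset.prod_pow_eq_pow_sum]
    refine Finset.prod_congr rfl fun i _ => ?_
    change ζ ^ ((ι i : ℕ) * (p * lam i)) = ζ ^ (p * (ι i : ℕ) % ℓ * lam i)
    rw [pow_mul ζ (p * (ι i : ℕ) % ℓ), ← pow_eq_pow_mod _ hζ.pow_eq_one, ← pow_mul]
    congr 1
    ring
end

section
/- Let ℓ ≥ 1 and let λ = (λ_1,…,λ_r) be a tuple of positive integers. Then Σ_λ(ℓ) = Σ over all set partitions 𝒫 of the index set {1,…,r} such that every block B ∈ 𝒫 satisfies ℓ ∣ Σ_{i∈B} λ_i, of the quantity ℓ^{#𝒫} · ∏_{B∈𝒫} (−1)^{#B−1}·(#B−1)!, where #𝒫 is the number of blocks of 𝒫 and #B the cardinality of the block B (an empty sum being 0). -/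
/-- `P` is a set partition of the finite set `s`. -/
def IsSetPartition {α : Type*} [DecidableEq α] (s : Finset α) (P : Finset (Finset α)) : Prop :=
  (∀ B ∈ P, B.Nonempty) ∧ (∀ B ∈ P, ∀ C ∈ P, B ≠ C → Disjoint B C) ∧ P.sup id = s

namespace IsSetPartition

variable {α : Type*} [DecidableEq α] {s : Finset α} {P : Finset (Finset α)}

theorem mem_iff (h : IsSetPartition s P) {x : α} : x ∈ s ↔ ∃ B ∈ P, x ∈ B := by
  rw [← h.2.2]; simp [Finset.mem_sup]

theorem eq_of_mem (h : IsSetPartition s P) {B C : Finset α} (hB : B ∈ P) (hC : C ∈ P) {x : α}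
    (hxB : x ∈ B) (hxC : x ∈ C) : B = C := by
  by_contra hne
  exact Finset.disjoint_left.1 (h.2.1 B hB C hC hne) hxB hxC

theorem of_forall (h₀ : ∀ B ∈ P, B.Nonempty)
    (h₁ : ∀ B ∈ P, ∀ C ∈ P, ∀ x, x ∈ B → x ∈ C → B = C)
    (h₂ : ∀ x, x ∈ s ↔ ∃ B ∈ P, x ∈ B) : IsSetPartition s P := by
  refine ⟨h₀, fun B hB C hC hne => ?_, ?_⟩
  · exact Finset.disjoint_left.2 fun x hx hx' => hne (h₁ B hB C hC x hx hx')
  · ext x; simp [Finset.mem_sup, h₂]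

theorem empty_notMem (h : IsSetPartition s P) : ∅ ∉ P := fun h' => by
  simpa using h.1 _ h'

/-- Adding a new element `a` to the block `C`, or as a singleton block if `C = ∅`. -/
theorem insert_block (h : IsSetPartition s P) {a : α} (ha : a ∉ s) {C : Finset α}
    (hC : C ∈ insert ∅ P) :
    IsSetPartition (insert a s) (insert (insert a C) (P.erase C)) := by
  have haP : ∀ B ∈ P, a ∉ B := fun B hB hx => ha (h.mem_iff.2 ⟨B, hB, hx⟩)
  have hCB : ∀ B ∈ P, B ≠ C → ∀ x ∈ C, x ∉ B := by
    intro B hB hne x hxC hxB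
    rcases Finset.mem_insert.1 hC with rfl | hC
    · simp at hxC
    · exact hne (h.eq_of_mem hB hC hxB hxC)
  refine of_forall ?_ ?_ ?_
  · intro B hB
    rcases Finset.mem_insert.1 hB with rfl | hB
    · exact Finset.insert_nonempty _ _
    · exact h.1 _ (Finset.mem_of_mem_erase hB)
  · intro B hB D hD x hxB hxD
    simp only [Finset.mem_insert, Finset.mem_erase] at hB hD
    rcases hB with rfl | ⟨hBC, hB⟩ <;> rcases hD with rfl | ⟨hDC, hD⟩
    · rfl
    · rcases Finset.mem_insert.1 hxB with rfl | hx
      · exact absurd hxD (haP _ hD)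
      · exact absurd hxD (hCB _ hD hDC _ hx)
    · rcases Finset.mem_insert.1 hxD with rfl | hx
      · exact absurd hxB (haP _ hB)
      · exact absurd hxB (hCB _ hB hBC _ hx)
    · exact h.eq_of_mem hB hD hxB hxD
  · intro x
    simp only [Finset.mem_insert, Finset.mem_erase, h.mem_iff]
    constructor
    · rintro (rfl | ⟨B, hB, hx⟩)
      · exact ⟨_, Or.inl rfl, by simp⟩
      · by_cases hBC : B = C
        · exact ⟨_, Or.inl rfl, by simp [← hBC, hx]⟩
        · exact ⟨B, Or.inr ⟨hBC, hB⟩, hx⟩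
    · rintro ⟨B, rfl | ⟨hBC, hB⟩, hx⟩
      · rcases Finset.mem_insert.1 hx with rfl | hx
        · exact Or.inl rfl
        · rcases Finset.mem_insert.1 hC with rfl | hC
          · simp at hx
          · exact Or.inr ⟨C, hC, hx⟩
      · exact Or.inr ⟨B, hB, hx⟩

theorem exists_insert_block {a : α} (ha : a ∉ s) (h : IsSetPartition (insert a s) P) :
    ∃ Q, IsSetPartition s Q ∧ ∃ C ∈ insert ∅ Q, insert (insert a C) (Q.erase C) = P := by
  obtain ⟨D, hD, haD⟩ := h.mem_iff.1 (Finset.mem_insert_self a s)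
  have haB : ∀ B ∈ P, B ≠ D → a ∉ B := fun B hB hne hx => hne (h.eq_of_mem hB hD hx haD)
  have hdisj : ∀ B ∈ P, B ≠ D → ∀ x ∈ B, x ∉ D :=
    fun B hB hne x hx hx' => hne (h.eq_of_mem hB hD hx hx')
  refine ⟨(insert (D.erase a) (P.erase D)).erase ∅, of_forall ?_ ?_ ?_, D.erase a, ?_, ?_⟩
  · intro B hB
    exact Finset.nonempty_iff_ne_empty.2 (Finset.mem_erase.1 hB).1
  · intro B hB C hC x hxB hxC
    simp only [Finset.mem_insert, Finset.mem_erase] at hB hC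
    rcases hB with ⟨-, rfl | ⟨hB, hB'⟩⟩ <;> rcases hC with ⟨-, rfl | ⟨hC, hC'⟩⟩
    · rfl
    · exact absurd (Finset.mem_of_mem_erase hxB) (hdisj _ hC' hC _ hxC)
    · exact absurd (Finset.mem_of_mem_erase hxC) (hdisj _ hB' hB _ hxB)
    · exact h.eq_of_mem hB' hC' hxB hxC
  · intro x
    constructor
    · intro hx
      have hxa : x ≠ a := fun e => ha (e ▸ hx)
      obtain ⟨B, hB, hxB⟩ := h.mem_iff.1 (Finset.mem_insert_of_mem hx)
      by_cases hBD : B = D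
      · have hx' : x ∈ D.erase a := Finset.mem_erase.2 ⟨hxa, hBD ▸ hxB⟩
        exact ⟨D.erase a, by simp [Finset.ne_empty_of_mem hx'], hx'⟩
      · exact ⟨B, by simp [Finset.ne_empty_of_mem hxB, hBD, hB], hxB⟩
    · rintro ⟨B, hB, hx⟩
      simp only [Finset.mem_insert, Finset.mem_erase] at hB
      rcases hB with ⟨-, rfl | ⟨hB, hB'⟩⟩
      · have hx' := Finset.mem_erase.1 hx
        exact Finset.mem_of_mem_insert_of_ne (h.mem_iff.2 ⟨D, hD, hx'.2⟩) hx'.1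
      · exact Finset.mem_of_mem_insert_of_ne (h.mem_iff.2 ⟨B, hB', hx⟩)
          fun e => haB B hB' hB (e ▸ hx)
  · by_cases hE : D.erase a = ∅ <;> simp [hE]
  · have hDP : D.erase a ∉ P := by
      intro hmem
      obtain ⟨x, hx⟩ := h.1 _ hmem
      have := h.eq_of_mem hmem hD hx (Finset.mem_of_mem_erase hx)
      rw [← this] at haD
      simp at haD
    ext B
    simp only [Finset.insert_erase haD, Finset.mem_insert, Finset.mem_erase]
    constructor
    · rintro (rfl | ⟨h1, -, rfl | ⟨-, h2⟩⟩)
      · exact hD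
      · exact absurd rfl h1
      · exact h2
    · intro hB
      by_cases hBD : B = D
      · exact Or.inl hBD
      · exact Or.inr ⟨fun e => hDP (e ▸ hB), (h.1 _ hB).ne_empty, Or.inr ⟨hBD, hB⟩⟩

theorem insert_block_injective {a : α} (ha : a ∉ s) {Q : Finset (Finset α)}
    (hP : IsSetPartition s P) (hQ : IsSetPartition s Q) {C D : Finset α}
    (hC : C ∈ insert ∅ P) (hD : D ∈ insert ∅ Q)
    (h : insert (insert a C) (P.erase C) = insert (insert a D) (Q.erase D)) :
    P = Q ∧ C = D := by
  have haP : ∀ B ∈ insert ∅ P, a ∉ B := fun B hB hx => by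
    rcases Finset.mem_insert.1 hB with rfl | hB
    · simp at hx
    · exact ha (hP.mem_iff.2 ⟨B, hB, hx⟩)
  have haQ : ∀ B ∈ insert ∅ Q, a ∉ B := fun B hB hx => by
    rcases Finset.mem_insert.1 hB with rfl | hB
    · simp at hx
    · exact ha (hQ.mem_iff.2 ⟨B, hB, hx⟩)
  have hCD : C = D := by
    have hmem : insert a C ∈ insert (insert a D) (Q.erase D) := h ▸ Finset.mem_insert_self _ _
    rcases Finset.mem_insert.1 hmem with e | e
    · rw [← Finset.erase_insert (haP C hC), e, Finset.erase_insert (haQ D hD)]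
    · exact absurd (Finset.mem_insert_self a C)
        (haQ _ (Finset.mem_insert_of_mem (Finset.mem_of_mem_erase e)))
  subst hCD
  have herase : P.erase C = Q.erase C := by
    have h1 : insert a C ∉ P.erase C := fun e =>
      haP _ (Finset.mem_insert_of_mem (Finset.mem_of_mem_erase e)) (Finset.mem_insert_self a C)
    have h2 : insert a C ∉ Q.erase C := fun e =>
      haQ _ (Finset.mem_insert_of_mem (Finset.mem_of_mem_erase e)) (Finset.mem_insert_self a C)
    rw [← Finset.erase_insert h1, h, Finset.erase_insert h2]
  refine ⟨?_, rfl⟩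
  by_cases hE : C = ∅
  · rw [hE, Finset.erase_eq_of_notMem hP.empty_notMem,
      Finset.erase_eq_of_notMem hQ.empty_notMem] at herase
    exact herase
  · rw [← Finset.insert_erase (Finset.mem_of_mem_insert_of_ne hC hE), herase,
      Finset.insert_erase (Finset.mem_of_mem_insert_of_ne hD hE)]

end IsSetPartition

open scoped Classical in
/-- The finite set of all set partitions of `s`. -/
noncomputable def setPartitions {α : Type*} (s : Finset α) :
    Finset (Finset (Finset α)) :=
  s.powerset.powerset.filter (IsSetPartition s)

open scoped Classical in
theorem mem_setPartitions {α : Type*} {s : Finset α} {P : Finset (Finset α)} :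
    P ∈ setPartitions s ↔ IsSetPartition s P := by
  simp only [setPartitions, Finset.mem_filter, Finset.mem_powerset, and_iff_right_iff_imp]
  intro h B hB
  exact Finset.mem_powerset.2 fun x hx => h.mem_iff.2 ⟨B, hB, hx⟩

open scoped Classical in
theorem sum_setPartitions_insert {α M : Type*} [AddCommMonoid M] {s : Finset α} {a : α}
    (ha : a ∉ s) (f : Finset (Finset α) → M) :
    ∑ P ∈ setPartitions (insert a s), f P =
      ∑ Q ∈ setPartitions s,
        (f (insert {a} Q) + ∑ C ∈ Q, f (insert (insert a C) (Q.erase C))) := by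
  have h1 : ∀ Q ∈ setPartitions s,
      f (insert {a} Q) + ∑ C ∈ Q, f (insert (insert a C) (Q.erase C)) =
        ∑ C ∈ insert ∅ Q, f (insert (insert a C) (Q.erase C)) := by
    intro Q hQ
    have hE := (mem_setPartitions.1 hQ).empty_notMem
    rw [Finset.sum_insert hE, Finset.erase_eq_of_notMem hE, insert_empty_eq]
  rw [Finset.sum_congr rfl h1, Finset.sum_sigma']
  symm
  refine Finset.sum_bij (fun x _ => insert (insert a x.2) (x.1.erase x.2)) ?_ ?_ ?_ ?_
  · rintro ⟨Q, C⟩ h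
    simp only [Finset.mem_sigma, mem_setPartitions] at h ⊢
    exact h.1.insert_block ha h.2
  · rintro ⟨Q, C⟩ h ⟨Q', C'⟩ h' e
    simp only [Finset.mem_sigma, mem_setPartitions] at h h'
    obtain ⟨rfl, rfl⟩ := IsSetPartition.insert_block_injective ha h.1 h'.1 h.2 h'.2 e
    rfl
  · intro P hP
    obtain ⟨Q, hQ, C, hC, e⟩ := (mem_setPartitions.1 hP).exists_insert_block ha
    exact ⟨⟨Q, C⟩, by simpa [mem_setPartitions, hQ] using hC, e⟩
  · intros; rfl

section

variable {R : Type*} [CommRing R]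

/-- The weight of a block `B`, for power sums `p` and exponents `lam`. -/
def blockWeight {α : Type*} (p : ℕ → R) (lam : α → ℕ) (B : Finset α) : R :=
  p (∑ i ∈ B, lam i) * ((-1) ^ (B.card - 1) * (Nat.factorial (B.card - 1) : R))

open scoped Classical in
theorem blockWeight_insert {α : Type*} (p : ℕ → R) (lam : α → ℕ) {a : α} {C : Finset α}
    (ha : a ∉ C) (hC : C.Nonempty) :
    blockWeight p lam (insert a C) =
      -∑ b ∈ C, blockWeight p (Function.update lam b (lam b + lam a)) C := by
  have h1 : ∀ b ∈ C, blockWeight p (Function.update lam b (lam b + lam a)) C =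
      p (lam a + ∑ i ∈ C, lam i) *
        ((-1) ^ (C.card - 1) * (Nat.factorial (C.card - 1) : R)) := by
    intro b hb
    have : ∑ i ∈ C, Function.update lam b (lam b + lam a) i = lam a + ∑ i ∈ C, lam i := by
      rw [Finset.sum_update_of_mem hb, ← Finset.add_sum_erase C lam hb, Finset.sdiff_singleton_eq_erase]
      ring
    rw [blockWeight, this]
  rw [Finset.sum_congr rfl h1, Finset.sum_const, blockWeight, Finset.sum_insert ha,
    Finset.card_insert_of_notMem ha]
  obtain ⟨k, hk⟩ := Nat.exists_eq_succ_of_ne_zero hC.card_pos.ne'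
  rw [hk]
  simp only [Nat.succ_eq_add_one, Nat.add_sub_cancel, Nat.factorial_succ, nsmul_eq_mul]
  push_cast
  ring

theorem blockWeight_update_of_notMem {α : Type*} [DecidableEq α] (p : ℕ → R) (lam : α → ℕ)
    {b : α} (x : ℕ) {B : Finset α} (hb : b ∉ B) :
    blockWeight p (Function.update lam b x) B = blockWeight p lam B := by
  rw [blockWeight, blockWeight, Finset.sum_update_of_notMem hb]

open scoped Classical in
theorem sum_setPartitions_insert_blockWeight {α : Type*} (p : ℕ → R) (lam : α → ℕ)
    {s : Finset α} {a : α} (ha : a ∉ s) :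
    ∑ P ∈ setPartitions (insert a s), ∏ B ∈ P, blockWeight p lam B =
      p (lam a) * ∑ P ∈ setPartitions s, ∏ B ∈ P, blockWeight p lam B -
        ∑ b ∈ s, ∑ P ∈ setPartitions s, ∏ B ∈ P,
          blockWeight p (Function.update lam b (lam b + lam a)) B := by
  rw [sum_setPartitions_insert ha, Finset.sum_comm (s := s), Finset.mul_sum,
    ← Finset.sum_sub_distrib]
  refine Finset.sum_congr rfl fun Q hQ => ?_
  have hQ := mem_setPartitions.1 hQ
  have haQ : ∀ B ∈ Q, a ∉ B := fun B hB hx => ha (hQ.mem_iff.2 ⟨B, hB, hx⟩)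
  have hs : s = Q.biUnion id := by ext x; simp [hQ.mem_iff]
  rw [sub_eq_add_neg]
  congr 1
  · rw [Finset.prod_insert fun h => haQ _ h (Finset.mem_singleton_self a)]
    simp [blockWeight]
  · rw [hs, Finset.sum_biUnion (t := id) fun B hB C hC hne => hQ.2.1 B hB C hC hne,
      ← Finset.sum_neg_distrib]
    refine Finset.sum_congr rfl fun C hC => ?_
    have hmem : insert a C ∉ Q.erase C := fun h =>
      haQ _ (Finset.mem_of_mem_erase h) (Finset.mem_insert_self a C)
    rw [Finset.prod_insert hmem, blockWeight_insert p lam (haQ C hC) (hQ.1 C hC), neg_mul,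
      Finset.sum_mul]
    congr 1
    refine Finset.sum_congr rfl fun b hb => ?_
    rw [← Finset.mul_prod_erase Q _ hC]
    congr 1
    refine Finset.prod_congr rfl fun B hB => ?_
    have hB := Finset.mem_erase.1 hB
    rw [blockWeight_update_of_notMem]
    exact fun hbB => hB.1 (hQ.eq_of_mem hB.2 hC hbB hb)

open scoped Classical in
theorem sum_injective_succ {β : Type*} [Fintype β] (v : β → R) {n : ℕ} (lam : Fin (n + 1) → ℕ) :
    ∑ ι : Fin (n + 1) → β with Function.Injective ι, ∏ i, v (ι i) ^ lam i =
      (∑ x, v x ^ lam 0) *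
          ∑ ι : Fin n → β with Function.Injective ι, ∏ i, v (ι i) ^ lam i.succ -
        ∑ b : Fin n, ∑ ι : Fin n → β with Function.Injective ι,
          ∏ i, v (ι i) ^ Function.update (lam ∘ Fin.succ) b (lam b.succ + lam 0) i := by
  have h1 : ∑ ι : Fin (n + 1) → β with Function.Injective ι, ∏ i, v (ι i) ^ lam i =
      ∑ ι : Fin n → β with Function.Injective ι, ∑ x with x ∉ Set.range ι,
        v x ^ lam 0 * ∏ i, v (ι i) ^ lam i.succ := by
    rw [Finset.sum_filter, ← (Fin.consEquiv fun _ : Fin (n + 1) => β).sum_comp,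
      Fintype.sum_prod_type_right, Finset.sum_filter]
    refine Finset.sum_congr rfl fun ι _ => ?_
    have hinj : ∀ x, Function.Injective (Fin.consEquiv (fun _ : Fin (n + 1) => β) (x, ι)) ↔
        x ∉ Set.range ι ∧ Function.Injective ι := fun x => Fin.cons_injective_iff
    simp only [hinj, Fin.consEquiv_apply, Fin.prod_univ_succ, Fin.cons_zero, Fin.cons_succ]
    by_cases h : Function.Injective ι <;> simp [h, Finset.sum_filter]
  rw [h1, Finset.sum_comm (s := Finset.univ (α := Fin n)), Finset.mul_sum,
    ← Finset.sum_sub_distrib]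
  refine Finset.sum_congr rfl fun ι hι => ?_
  have hι : Function.Injective ι := (Finset.mem_filter.1 hι).2
  have h2 : ∑ x with x ∉ Set.range ι, v x ^ lam 0 =
      ∑ x, v x ^ lam 0 - ∑ b, v (ι b) ^ lam 0 := by
    rw [eq_sub_iff_add_eq, ← Finset.sum_filter_not_add_sum_filter Finset.univ (fun x => x ∈ Set.range ι)]
    congr 1
    rw [← Finset.sum_image (s := Finset.univ) (f := fun x => v x ^ lam 0) hι.injOn]
    refine Finset.sum_congr ?_ fun _ _ => rfl
    ext; simp
  rw [← Finset.sum_mul, h2, sub_mul, Finset.sum_mul (s := Finset.univ (α := Fin n))]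
  congr 1
  refine Finset.sum_congr rfl fun b _ => ?_
  rw [← Finset.mul_prod_erase _ _ (Finset.mem_univ b),
    ← Finset.mul_prod_erase _ (fun i => v (ι i) ^ Function.update _ b _ i) (Finset.mem_univ b)]
  rw [Function.update_self, pow_add, ← mul_assoc, mul_comm (v (ι b) ^ lam 0)]
  congr 1
  refine Finset.prod_congr rfl fun i hi => ?_
  rw [Function.update_of_ne (Finset.ne_of_mem_erase hi), Function.comp_apply]

open scoped Classical in
/-- Expansion of an augmented monomial symmetric polynomial in power sums. -/
theorem sum_injective_eq_sum_setPartitions {α β : Type*} [Fintype β] (v : β → R) {n : ℕ}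
    (e : Fin n → α) (he : Function.Injective e) (lam : α → ℕ) :
    ∑ ι : Fin n → β with Function.Injective ι, ∏ i, v (ι i) ^ lam (e i) =
      ∑ P ∈ setPartitions (Finset.univ.image e),
        ∏ B ∈ P, blockWeight (fun m => ∑ x, v x ^ m) lam B := by
  induction n generalizing lam with
  | zero =>
    have h : setPartitions (∅ : Finset α) = {∅} := by
      ext P
      simp only [mem_setPartitions, Finset.mem_singleton]
      constructor
      · intro h
        refine Finset.eq_empty_of_forall_notMem fun B hB => ?_
        obtain ⟨x, hx⟩ := h.1 B hB
        simpa using h.mem_iff.2 ⟨B, hB, hx⟩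
      · rintro rfl
        exact IsSetPartition.of_forall (by simp) (by simp) (by simp)
    have hi : ∀ ι : Fin 0 → β, Function.Injective ι := fun ι => Function.injective_of_subsingleton ι
    simp [h, hi]
  | succ n ih =>
    have he' : Function.Injective (e ∘ Fin.succ) := he.comp (Fin.succ_injective n)
    have hs : Finset.univ.image e = insert (e 0) (Finset.univ.image (e ∘ Fin.succ)) := by
      ext x; simp [Fin.exists_fin_succ, eq_comm]
    have h0 : e 0 ∉ Finset.univ.image (e ∘ Fin.succ) := by
      simp [he.eq_iff, Fin.succ_ne_zero]
    rw [sum_injective_succ v (fun i => lam (e i)), hs, sum_setPartitions_insert_blockWeight _ _ h0,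
      Finset.sum_image he'.injOn, ← ih _ he' lam]
    congr 1
    refine Finset.sum_congr rfl fun b _ => ?_
    rw [← ih _ he']
    refine Finset.sum_congr rfl fun ι _ => Finset.prod_congr rfl fun i _ => ?_
    congr 1
    exact (congrFun (Function.update_comp_eq_of_injective lam he' b _) i).symm

end

theorem IsPrimitiveRoot.sum_fin_pow_pow {ℓ : ℕ} {ζ : ℂ} (hζ : IsPrimitiveRoot ζ ℓ) (m : ℕ) :
    ∑ x : Fin ℓ, (ζ ^ (x : ℕ)) ^ m = if ℓ ∣ m then (ℓ : ℂ) else 0 := by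
  have h : ∀ x : ℕ, (ζ ^ x) ^ m = (ζ ^ m) ^ x := fun x => pow_right_comm _ _ _
  simp only [h]
  rw [Fin.sum_univ_eq_sum_range (fun x => (ζ ^ m) ^ x)]
  split_ifs with hd
  · simp [(hζ.pow_eq_one_iff_dvd m).2 hd]
  · have hne : ζ ^ m ≠ 1 := fun e => hd ((hζ.pow_eq_one_iff_dvd m).1 e)
    rw [geom_sum_eq hne, h ℓ |>.symm, hζ.pow_eq_one]
    simp


open scoped Classical in
/-- For `ℓ ≥ 1` and a tuple `λ = (λ_1,…,λ_r)` of positive integers,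
`Σ_λ(ℓ)` equals the sum, over all set partitions `𝒫` of `{1,…,r}` all of whose blocks `B`
satisfy `ℓ ∣ ∑_{i∈B} λ_i`, of `ℓ^{#𝒫} · ∏_{B∈𝒫} (−1)^{#B−1}·(#B−1)!`. -/
theorem stmt6 (ℓ : ℕ) (hℓ : 1 ≤ ℓ) (ζ : ℂ) (hζ : IsPrimitiveRoot ζ ℓ)
    (r : ℕ) (lam : Fin r → ℕ) (hlam : ∀ i, 1 ≤ lam i) :
    (∑ ι ∈ Finset.univ.filter (fun ι : Fin r → Fin ℓ => Function.Injective ι),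
        ζ ^ (∑ i, (ι i : ℕ) * lam i)) =
      ∑ P ∈ Finset.univ.filter (fun P : Finset (Finset (Fin r)) =>
          (∀ B ∈ P, B.Nonempty) ∧
          (∀ B ∈ P, ∀ C ∈ P, B ≠ C → Disjoint B C) ∧
          P.sup id = Finset.univ ∧
          (∀ B ∈ P, ℓ ∣ ∑ i ∈ B, lam i)),
        (ℓ : ℂ) ^ P.card *
          ∏ B ∈ P, (-1 : ℂ) ^ (B.card - 1) * (Nat.factorial (B.card - 1) : ℂ) := by
  have h1 := sum_injective_eq_sum_setPartitions (fun x : Fin ℓ => ζ ^ (x : ℕ)) id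
    (Function.injective_id (α := Fin r)) lam
  simp only [id, ← pow_mul, Finset.prod_pow_eq_pow_sum] at h1
  refine Eq.trans (by congr!) (h1.trans ?_)
  rw [@Finset.image_id _ _ (fun a b => Classical.propDecidable (a = b))]
  simp only [pow_mul, hζ.sum_fin_pow_pow]
  have h2 : (Finset.univ.filter (fun P : Finset (Finset (Fin r)) =>
      (∀ B ∈ P, B.Nonempty) ∧ (∀ B ∈ P, ∀ C ∈ P, B ≠ C → Disjoint B C) ∧
      P.sup id = Finset.univ ∧ (∀ B ∈ P, ℓ ∣ ∑ i ∈ B, lam i))) =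
      (setPartitions Finset.univ).filter (fun P => ∀ B ∈ P, ℓ ∣ ∑ i ∈ B, lam i) := by
    ext P
    simp only [Finset.mem_filter, Finset.mem_univ, true_and, mem_setPartitions, IsSetPartition,
      and_assoc]
    convert Iff.rfl
  rw [h2, Finset.sum_filter]
  refine Finset.sum_congr rfl fun P _ => ?_
  split_ifs with hP
  · rw [← Finset.prod_const, ← Finset.prod_mul_distrib]
    refine Finset.prod_congr rfl fun B hB => ?_
    rw [blockWeight, if_pos (hP B hB)]
  · push Not at hP
    obtain ⟨B, hB, hd⟩ := hP
    exact Finset.prod_eq_zero hB (by rw [blockWeight, if_neg hd, zero_mul])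
end

section
/- For every n ≥ 1, the sum of (−1)^{e(G)} over all connected simple graphs G on the labeled vertex set {1,…,n}, where e(G) denotes the number of edges of G, equals (−1)^{n−1}·(n−1)!. -/
open Polynomial in
/-- The linear coefficient of the falling factorial polynomial. -/
theorem descPochhammer_int_coeff_one (m : ℕ) :
    (descPochhammer ℤ (m + 1)).coeff 1 = (-1) ^ m * (m.factorial : ℤ) := by
  have h : (descPochhammer ℤ m).eval (-1) = (-1) ^ m * (m.factorial : ℤ) := by
    rw [descPochhammer_eval_eq_ascPochhammer,
      show (-1 : ℤ) - m + 1 = -(m : ℤ) by ring, ascPochhammer_eval_neg_eq_descPochhammer,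
      descPochhammer_eval_eq_descFactorial, Nat.descFactorial_self]
  rw [descPochhammer_succ_left, coeff_X_mul, coeff_zero_eq_eval_zero, eval_comp]
  simpa using h

namespace SimpleGraph

variable {V : Type*}

/-- Functions constant on the connected components of `G` are those for which every edge of `G`
lies inside a fibre. -/
def connectedComponentFunEquiv (G : SimpleGraph V) (α : Type*) :
    (G.ConnectedComponent → α) ≃ {f : V → α // G ≤ ((⊤ : SimpleGraph α).comap f)ᶜ} where
  toFun g := ⟨fun v => g (G.connectedComponentMk v), fun u v h => by
    simp [h.ne, ConnectedComponent.sound h.reachable]⟩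
  invFun f := Quot.lift f.1 fun u v h => by
    obtain ⟨p⟩ := h
    induction p with
    | nil => rfl
    | cons h _ ih =>
      have := f.2 h
      simp only [compl_adj, comap_adj, top_adj, not_not] at this
      exact this.2.trans ih
  left_inv g := by
    ext c
    induction c using ConnectedComponent.ind
    rfl
  right_inv f := rfl

theorem compl_comap_top_eq_bot_iff {α : Type*} (f : V → α) :
    ((⊤ : SimpleGraph α).comap f)ᶜ = ⊥ ↔ Function.Injective f := by
  rw [← le_bot_iff]
  refine ⟨fun h u v huv => ?_, fun h u v huv => ?_⟩
  · by_contra hne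
    exact h (show (((⊤ : SimpleGraph α).comap f)ᶜ).Adj u v by simp [hne, huv])
  · simp only [compl_adj, comap_adj, top_adj, not_not] at huv
    exact huv.1 (h huv.2)

open scoped Classical in
theorem connected_iff_card_connectedComponent_eq_one [Fintype V] (G : SimpleGraph V) :
    G.Connected ↔ Fintype.card G.ConnectedComponent = 1 := by
  rw [Fintype.card_eq_one_iff_nonempty_unique]
  constructor
  · intro h
    have := h.nonempty
    have := h.preconnected.subsingleton_connectedComponent
    exact ⟨_root_.uniqueOfSubsingleton (Classical.arbitrary _)⟩
  · rintro ⟨h⟩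
    obtain ⟨v, -⟩ := h.default.exists_rep
    have : Nonempty V := ⟨v⟩
    exact ⟨fun u w => ConnectedComponent.exact (Subsingleton.elim _ _)⟩

open scoped Classical in
/-- The signed count of the spanning subgraphs of `K` vanishes unless `K` has no edges. -/
theorem sum_le_neg_one_pow_card_edgeFinset [Fintype V] (K : SimpleGraph V) :
    (∑ G : SimpleGraph V, if G ≤ K then (-1 : ℤ) ^ G.edgeFinset.card else 0) =
      if K = ⊥ then 1 else 0 := by
  rw [← Finset.sum_filter]
  trans ∑ s ∈ K.edgeFinset.powerset, (-1 : ℤ) ^ s.card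
  · refine Finset.sum_bij' (fun G _ => G.edgeFinset)
      (fun s _ => fromEdgeSet (s : Set (Sym2 V))) ?_ ?_ ?_ ?_ ?_
    · intro G hG
      simpa using hG
    · intro s hs
      have hs' : (s : Set (Sym2 V)) ⊆ K.edgeSet := by
        simpa [← Finset.coe_subset] using hs
      simpa using (fromEdgeSet_mono hs').trans (fromEdgeSet_edgeSet K).le
    · intro G _
      simp
    · intro s hs
      have hs' : (s : Set (Sym2 V)) ⊆ K.edgeSet := by
        simpa [← Finset.coe_subset] using hs
      rw [← Finset.coe_inj, coe_edgeFinset, edgeSet_fromEdgeSet, sdiff_eq_left]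
      exact Set.disjoint_left.2 fun e he => K.not_isDiag_of_mem_edgeSet (hs' he)
    · intros
      rfl
  · rw [Finset.sum_powerset_neg_one_pow_card]
    simp

open scoped Classical in
/-- The subgraph expansion of the chromatic polynomial of the complete graph. -/
theorem sum_neg_one_pow_card_edgeFinset_mul_X_pow [Fintype V] :
    (∑ G : SimpleGraph V, Polynomial.C ((-1 : ℤ) ^ G.edgeFinset.card) *
      Polynomial.X ^ Fintype.card G.ConnectedComponent) =
      descPochhammer ℤ (Fintype.card V) := by
  refine Polynomial.eq_of_infinite_eval_eq _ _
    ((Set.infinite_range_of_injective (Nat.cast_injective (R := ℤ))).mono ?_)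
  rintro _ ⟨q, rfl⟩
  rw [Set.mem_ofPred_eq, descPochhammer_eval_eq_descFactorial, Polynomial.eval_finsetSum]
  have key (G : SimpleGraph V) : (q : ℤ) ^ Fintype.card G.ConnectedComponent =
      ∑ f : V → Fin q, if G ≤ ((⊤ : SimpleGraph (Fin q)).comap f)ᶜ then 1 else 0 := by
    have h := Fintype.card_congr (G.connectedComponentFunEquiv (Fin q))
    rw [Fintype.card_fun, Fintype.card_fin, Fintype.card_subtype] at h
    rw [Finset.sum_boole, ← h, Nat.cast_pow]
  simp only [Polynomial.eval_mul, Polynomial.eval_C, Polynomial.eval_pow, Polynomial.eval_X, key,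
    Finset.mul_sum, mul_ite, mul_one, mul_zero]
  rw [Finset.sum_comm]
  simp only [sum_le_neg_one_pow_card_edgeFinset, compl_comap_top_eq_bot_iff]
  rw [Finset.sum_boole, ← Fintype.card_subtype,
    Fintype.card_congr (Equiv.subtypeInjectiveEquivEmbedding V (Fin q)),
    Fintype.card_embedding_eq, Fintype.card_fin]

end SimpleGraph

open scoped Classical in
/-- For every `n ≥ 1`, the sum of `(−1)^{e(G)}` over all connected simple
graphs `G` on the labeled vertex set `{1,…,n}` (where `e(G)` is the number of edges of `G`)
equals `(−1)^{n−1}·(n−1)!`. -/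
theorem stmt7 (n : ℕ) (hn : 1 ≤ n) :
    (∑ G : SimpleGraph (Fin n), if G.Connected then (-1 : ℤ) ^ G.edgeFinset.card else 0) =
      (-1) ^ (n - 1) * (Nat.factorial (n - 1) : ℤ) := by
  obtain ⟨m, rfl⟩ := Nat.exists_eq_add_of_le' hn
  have h := congrArg (fun p => Polynomial.coeff p 1)
    (SimpleGraph.sum_neg_one_pow_card_edgeFinset_mul_X_pow (V := Fin (m + 1)))
  simp only [Fintype.card_fin, descPochhammer_int_coeff_one, Polynomial.finsetSum_coeff,
    Polynomial.coeff_C_mul, Polynomial.coeff_X_pow, mul_ite, mul_one, mul_zero] at h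
  rw [Nat.add_sub_cancel, ← h]
  refine Finset.sum_congr (by ext; simp) fun G _ => ?_
  exact if_congr (G.connected_iff_card_connectedComponent_eq_one.trans eq_comm) rfl rfl
end

section
/- Let L/K be a totally ramified cyclic Galois extension of degree p² (respectively p³), and let v_L be the normalized valuation of L (so v_L takes the value 1 on uniformizers of L). Then for every uniformizer π_L of L and every non-identity σ ∈ Gal(L/K): v_L(σ(π_L) − π_L) = 2 if σ has order p² (resp. p³), and v_L(σ(π_L) − π_L) = p+2 if σ has order p (resp. p+2 if σ has order p², and p²+p+2 if σ has order p); equivalently, the lower ramification jumps of L/K are 1 and p+1 (resp. 1, p+1 and p²+p+1). Consequently the different 𝒟_{L/K} satisfies v_L(𝒟_{L/K}) = 3p² − p − 2 (resp. 4p³ − p² − p − 2). -/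
open Polynomial
open scoped Classical

/-- The composite algebra structure `ℤ_[p] → ℚ_[p] → K`. -/
noncomputable instance zpAlgebra (p : ℕ) [Fact (Nat.Prime p)] (K : Type) [Field K]
    [Algebra ℚ_[p] K] : Algebra ℤ_[p] K :=
  ((algebraMap ℚ_[p] K).comp (algebraMap ℤ_[p] ℚ_[p])).toAlgebra

namespace TotallyRamified

section Displacement

variable {A : Type*} [CommRing A] {π : A} {s n : ℕ}

/-- A ring endomorphism `f` moving `π` by a multiple of `π ^ (s + 1)` moves everything by such a
multiple, provided every element is congruent modulo `π` to a fixed point of `f`. -/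
theorem pow_dvd_map_sub (f : A →+* A) (res : ∀ x, ∃ a, f a = a ∧ π ∣ x - a)
    (h : π ^ (s + 1) ∣ f π - π) (x : A) : π ^ (s + 1) ∣ f x - x := by
  have hfπ : π ∣ f π := by
    have h1 : π ∣ f π - π := (dvd_pow_self π s.succ_ne_zero).trans h
    simpa using dvd_add h1 (dvd_refl π)
  suffices H : ∀ t ≤ s + 1, ∀ x, π ^ t ∣ f x - x from H _ le_rfl x
  intro t
  induction t with
  | zero => simp
  | succ t ih =>
    intro ht x
    obtain ⟨a, ha, y, hy⟩ := res x
    obtain rfl : x = a + π * y := by rw [← hy]; ring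
    have e : f (a + π * y) - (a + π * y) = f π * (f y - y) + y * (f π - π) := by
      rw [map_add, map_mul, ha]; ring
    rw [e]
    refine dvd_add ?_ (((pow_dvd_pow π ht).trans h).mul_left _)
    rw [pow_succ']
    exact mul_dvd_mul hfπ (ih (by omega) y)

/-- First-order expansion of the displacement of `π ^ n * y`. -/
theorem pow_dvd_map_pow_mul_sub (f : A →+* A) (res : ∀ x, ∃ a, f a = a ∧ π ∣ x - a)
    (hs : 1 ≤ s) {c : A} (h : f π - π = π ^ (s + 1) * c) (n : ℕ) (y : A) :
    π ^ (n + s + 1) ∣ f (π ^ n * y) - π ^ n * y - n * c * y * π ^ (n + s) := by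
  obtain ⟨z, hz⟩ := pow_dvd_map_sub f res (s := s) ⟨c, h⟩ y
  obtain ⟨q, hq⟩ := Polynomial.powAddExpansion 1 (π ^ s * c) n
  have hfπ : f π = π * (1 + π ^ s * c) := by linear_combination h
  have hfy : f y = y + π ^ (s + 1) * z := by linear_combination hz
  rw [map_mul, map_pow, hfπ, mul_pow, hq, hfy]
  obtain ⟨t, rfl⟩ := Nat.exists_eq_add_of_le' hs
  refine ⟨z * (1 + n * (π ^ (t + 1) * c) + q * (π ^ (t + 1) * c) ^ 2) + y * q * c ^ 2 * π ^ t, ?_⟩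
  simp only [one_pow, mul_one]
  ring

theorem pow_add_dvd_map_sub (f : A →+* A) (res : ∀ x, ∃ a, f a = a ∧ π ∣ x - a)
    (hs : 1 ≤ s) (h : π ^ (s + 1) ∣ f π - π) {x : A} (hx : π ^ n ∣ x) :
    π ^ (n + s) ∣ f x - x := by
  obtain ⟨c, hc⟩ := h
  obtain ⟨y, rfl⟩ := hx
  have := (pow_dvd_pow π (Nat.le_succ (n + s))).trans (pow_dvd_map_pow_mul_sub f res hs hc n y)
  simpa using dvd_add this (Dvd.intro_left (n * c * y) rfl)

theorem pow_add_succ_dvd_map_sub (f : A →+* A) (res : ∀ x, ∃ a, f a = a ∧ π ∣ x - a)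
    (hs : 1 ≤ s) (h : π ^ (s + 1) ∣ f π - π) (hn : π ∣ (n : A)) {x : A} (hx : π ^ n ∣ x) :
    π ^ (n + s + 1) ∣ f x - x := by
  obtain ⟨c, hc⟩ := h
  obtain ⟨y, rfl⟩ := hx
  have h2 : π ^ (n + s + 1) ∣ n * c * y * π ^ (n + s) := by
    rw [pow_succ', mul_assoc, mul_assoc]
    exact mul_dvd_mul hn (((dvd_refl _).mul_left _).mul_left _)
  simpa using dvd_add (pow_dvd_map_pow_mul_sub f res hs hc n y) h2

/-- The additive endomorphism `x ↦ f x - x`. -/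
def displacement (f : A →+* A) : Module.End ℤ A := f.toAddMonoidHom.toIntLinearMap - 1

theorem displacement_apply (f : A →+* A) (x : A) : displacement f x = f x - x := rfl

theorem pow_dvd_displacement_pow (f : A →+* A) (res : ∀ x, ∃ a, f a = a ∧ π ∣ x - a)
    (hs : 1 ≤ s) (h : π ^ (s + 1) ∣ f π - π) (j : ℕ) {x : A} (hx : π ^ n ∣ x) :
    π ^ (n + j * s) ∣ (displacement f ^ j) x := by
  induction j with
  | zero => simpa using hx
  | succ j ih =>
    rw [pow_succ', Module.End.mul_apply, displacement_apply, add_mul, one_mul, ← add_assoc]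
    exact pow_add_dvd_map_sub f res hs h ih

theorem iterate_eq_sum_displacement (f : A →+* A) (m : ℕ) (x : A) :
    f^[m] x = ∑ j ∈ Finset.range (m + 1), (m.choose j : A) * (displacement f ^ j) x := by
  have h1 : ∀ m : ℕ, f^[m] x = ((displacement f + 1) ^ m) x := by
    intro m
    induction m with
    | zero => simp
    | succ m ih =>
      rw [Function.iterate_succ_apply', ih, pow_succ', Module.End.mul_apply]
      simp [displacement_apply]
  rw [h1, (Commute.one_right (displacement f)).add_pow, LinearMap.sum_apply]
  refine Finset.sum_congr rfl fun j _ => ?_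
  rw [one_pow, mul_one, ← Nat.cast_comm, Module.End.mul_apply]
  simp

variable {p N : ℕ}

/-- The binomial expansion of `f ^ p - 1` in powers of `f - 1`, up to terms of high order. -/
theorem pow_dvd_iterate_prime_sub (hp : p.Prime) (hpN : π ^ N ∣ (p : A)) (f : A →+* A)
    (res : ∀ x, ∃ a, f a = a ∧ π ∣ x - a) (hs : 1 ≤ s) (h : π ^ (s + 1) ∣ f π - π) :
    π ^ (N + 1 + 2 * s) ∣
      f^[p] π - π - p * (f π - π) - (displacement f ^ p) π := by
  have hp2 := hp.two_le
  have e : f^[p] π - π - p * (f π - π) - (displacement f ^ p) π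
      = ∑ j ∈ Finset.Ico 2 p, (p.choose j : A) * (displacement f ^ j) π := by
    rw [iterate_eq_sum_displacement, Finset.sum_range_succ, Finset.range_eq_Ico,
      Finset.sum_eq_sum_Ico_succ_bot (by omega), Finset.sum_eq_sum_Ico_succ_bot (by omega)]
    simp [displacement_apply]
    ring
  rw [e]
  refine Finset.dvd_sum fun j hj => ?_
  rw [Finset.mem_Ico] at hj
  rw [add_assoc, pow_add]
  refine mul_dvd_mul (hpN.trans (Nat.cast_dvd_cast (hp.dvd_choose_self (by omega) hj.2))) ?_
  exact (pow_dvd_pow π (by gcongr; exact hj.1)).trans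
    (pow_dvd_displacement_pow f res hs h j (n := 1) (by simp))

theorem pow_dvd_iterate_prime_sub_of_le (hp : p.Prime) (hpN : π ^ N ∣ (p : A)) (f : A →+* A)
    (res : ∀ x, ∃ a, f a = a ∧ π ∣ x - a) (hs : 1 ≤ s) (h : π ^ (s + 1) ∣ f π - π) {m : ℕ}
    (hm : m ≤ N + s + 1) (hD : π ^ m ∣ (displacement f ^ p) π) : π ^ m ∣ f^[p] π - π := by
  have h1 := (pow_dvd_pow π (by omega : m ≤ N + 1 + 2 * s)).trans
    (pow_dvd_iterate_prime_sub hp hpN f res hs h)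
  have h2 : π ^ m ∣ p * (f π - π) := by
    refine (pow_dvd_pow π (by omega : m ≤ N + (s + 1))).trans ?_
    rw [pow_add]
    exact mul_dvd_mul hpN h
  convert (h1.add h2).add hD using 1
  ring

theorem pow_dvd_iterate_prime_sub_of_le_mul (hp : p.Prime) (hpN : π ^ N ∣ (p : A)) (f : A →+* A)
    (res : ∀ x, ∃ a, f a = a ∧ π ∣ x - a) (hs : 1 ≤ s) (h : π ^ (s + 1) ∣ f π - π) {m : ℕ}
    (hm : m ≤ N + s + 1) (hm' : m ≤ p * s + 1) : π ^ m ∣ f^[p] π - π :=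
  pow_dvd_iterate_prime_sub_of_le hp hpN f res hs h hm <|
    (pow_dvd_pow π (by omega)).trans
      (pow_dvd_displacement_pow f res hs h p (n := 1) (by simp))

theorem pow_dvd_iterate_prime_sub_of_modEq (hp : p.Prime) (hN : N ≠ 0) (hpN : π ^ N ∣ (p : A))
    (f : A →+* A) (res : ∀ x, ∃ a, f a = a ∧ π ∣ x - a) (hs : 1 ≤ s)
    (h : π ^ (s + 1) ∣ f π - π) (hsp : p ∣ s - 1) (hN' : p * s + 1 ≤ N + s) :
    π ^ (p * s + 2) ∣ f^[p] π - π := by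
  refine pow_dvd_iterate_prime_sub_of_le hp hpN f res hs h (by omega) ?_
  obtain ⟨q, rfl⟩ : ∃ q, p = q + 1 := ⟨p - 1, by have := hp.pos; omega⟩
  have hdvd : q + 1 ∣ 1 + q * s := by
    obtain ⟨t, ht⟩ := hsp
    refine ⟨1 + q * t, ?_⟩
    obtain rfl : s = (q + 1) * t + 1 := by omega
    ring
  have hπ : π ∣ ((1 + q * s : ℕ) : A) :=
    ((dvd_pow_self π hN).trans hpN).trans (Nat.cast_dvd_cast hdvd)
  rw [pow_succ' (displacement f), Module.End.mul_apply, displacement_apply]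
  convert pow_add_succ_dvd_map_sub f res hs h hπ
    (pow_dvd_displacement_pow f res hs h q (n := 1) (x := π) (by simp)) using 2
  ring

/-- An endomorphism of order `p` that moves `π` by too little fixes `π` to all orders. -/
theorem pow_dvd_map_sub_of_iterate_prime_eq [IsDomain A] (hp : p.Prime) (hπ : π ≠ 0) {u : A}
    (hu : IsUnit u) (hpN : (p : A) = u * π ^ N) (f : A →+* A)
    (res : ∀ x, ∃ a, f a = a ∧ π ∣ x - a) (hs : 1 ≤ s) (h : π ^ (s + 1) ∣ f π - π)
    (hf : f^[p] π = π) (hN : N + s < p * s) (t : ℕ) : π ^ (s + t + 1) ∣ f π - π := by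
  induction t with
  | zero => exact h
  | succ t ih =>
    have hst : 1 ≤ s + t := by omega
    have h1 := pow_dvd_iterate_prime_sub hp (Dvd.intro_left u hpN.symm) f res hst ih
    have h2 := pow_dvd_displacement_pow f res hst ih p (n := 1) (x := π) (by simp)
    have h3 : N + (s + t) < p * (s + t) := by nlinarith [hp.two_le]
    have h4 : π ^ (N + (s + t + 2)) ∣ p * (f π - π) := by
      have := ((pow_dvd_pow π (by omega : N + (s + t + 2) ≤ N + 1 + 2 * (s + t))).trans h1).add
        ((pow_dvd_pow π (by omega : N + (s + t + 2) ≤ 1 + p * (s + t))).trans h2)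
      rw [hf] at this
      rw [← dvd_neg]
      convert this using 1
      ring
    rw [hpN, mul_assoc, hu.dvd_mul_left, pow_add, mul_dvd_mul_iff_left (pow_ne_zero _ hπ)] at h4
    exact h4

end Displacement

section Order

theorem fixed_pow {A : Type*} [CommRing A] {f : A →+* A} {a : A} (h : f a = a) (m : ℕ) : (f ^ m) a = a := by
  rw [RingHom.coe_pow]
  exact Function.iterate_fixed h m

theorem map_uniformizer_dvd_of_pow_eq {A : Type*} [CommRing A] {π : A} (hπu : ¬IsUnit π)
    (hmax : ∀ x, ¬IsUnit x → π ∣ x) {N : ℕ} (hN : N ≠ 0) (f : A →+* A)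
    (hf : (f ^ N) π = π) : π ∣ f π := by
  refine hmax _ fun hu => hπu ?_
  obtain ⟨M, rfl⟩ := Nat.exists_eq_succ_of_ne_zero hN
  rw [← hf, pow_succ]
  exact hu.map (f ^ M)

variable {A : Type*} [CommRing A] [IsDomain A] {π : A} {p k : ℕ}

/-- Endomorphisms of `p`-power order act trivially on uniformizers to first order. -/
theorem sq_dvd_map_sub (hp : p.Prime) (hπ : π ≠ 0) (hπu : ¬IsUnit π)
    (hmax : ∀ x, ¬IsUnit x → π ∣ x) (hπp : π ∣ (p : A)) (f : A →+* A)
    (res : ∀ x, ∃ a, f a = a ∧ π ∣ x - a) (hf : (f ^ p ^ k) π = π) :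
    π ^ 2 ∣ f π - π := by
  have hN : p ^ k ≠ 0 := pow_ne_zero _ hp.ne_zero
  obtain ⟨u, hu⟩ := map_uniformizer_dvd_of_pow_eq hπu hmax hN f hf
  have hres : ∀ x, π ∣ f x - x := by
    simpa using pow_dvd_map_sub f res (s := 0) (by simp [hu])
  have key : ∀ m : ℕ, ∃ w, (f ^ m) π = π * w ∧ π ∣ w - u ^ m := by
    intro m
    induction m with
    | zero => exact ⟨1, by simp⟩
    | succ m ih =>
      obtain ⟨w, hw, hw'⟩ := ih
      refine ⟨u * f w, ?_, ?_⟩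
      · rw [pow_succ', RingHom.mul_def, RingHom.comp_apply, hw, map_mul, hu, mul_assoc]
      · convert ((hres w).mul_left u).add (hw'.mul_left u) using 1
        ring
  obtain ⟨w, hw, hw'⟩ := key (p ^ k)
  obtain rfl : w = 1 := mul_left_cancel₀ hπ (by rw [← hw, hf, mul_one])
  obtain ⟨r, hr⟩ := exists_add_pow_prime_pow_eq hp (u - 1) 1 k
  have h1 : π ∣ (u - 1) ^ p ^ k := by
    have h2 := hw'.add (hπp.mul_right ((u - 1) * r))
    rw [← dvd_neg]
    convert h2 using 1
    simp only [sub_add_cancel, one_pow] at hr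
    rw [hr]
    ring
  have h2 : π ∣ u - 1 := hmax _ fun h => hπu (isUnit_of_dvd_unit h1 (h.pow _))
  rw [hu, sq]
  convert mul_dvd_mul_left π h2 using 1
  ring

theorem mul_geom_sum_add_one (p n : ℕ) :
    p * ∑ i ∈ Finset.range n, p ^ i + 1 = ∑ i ∈ Finset.range n, p ^ i + p ^ n := by
  rw [← Finset.sum_range_succ, geom_sum_succ]

variable {u : A}

/-- Lower bound for the ramification numbers of the `p`-power iterates. -/
theorem pow_dvd_pow_map_sub (hp : p.Prime) (hπ : π ≠ 0) (hπu : ¬IsUnit π)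
    (hmax : ∀ x, ¬IsUnit x → π ∣ x) (hpN : π ^ p ^ k ∣ (p : A)) (f : A →+* A)
    (res : ∀ x, ∃ a, f a = a ∧ π ∣ x - a) (hf : (f ^ p ^ k) π = π) {n : ℕ} (hn : n < k) :
    π ^ (1 + ∑ i ∈ Finset.range (n + 1), p ^ i) ∣ (f ^ p ^ n) π - π := by
  have hN : p ^ k ≠ 0 := pow_ne_zero _ hp.ne_zero
  induction n with
  | zero =>
    simpa using sq_dvd_map_sub hp hπ hπu hmax ((dvd_pow_self π hN).trans hpN) f res hf
  | succ n ih =>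
    have h1 := ih (by omega)
    rw [add_comm] at h1
    have hres : ∀ x, ∃ a, (f ^ p ^ n) a = a ∧ π ∣ x - a := fun x => by
      obtain ⟨a, ha, hx⟩ := res x
      exact ⟨a, fixed_pow ha _, hx⟩
    have hgeom := geom_sum_succ (x := p) (n := n)
    have hle : p ^ (n + 1) ≤ p ^ k := Nat.pow_le_pow_right hp.pos hn.le
    have h2 := pow_dvd_iterate_prime_sub_of_modEq hp hN hpN (f ^ p ^ n) hres (by omega) h1
      ⟨∑ i ∈ Finset.range n, p ^ i, by omega⟩
      (by have := mul_geom_sum_add_one p (n + 1); omega)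
    rw [← RingHom.coe_pow, ← pow_mul, ← pow_succ] at h2
    convert h2 using 2
    rw [geom_sum_succ]
    ring

/-- Upper bound for the ramification number of an endomorphism of order `p ^ (j + 1)`: if it is
exceeded, then the `p ^ j`-th iterate fixes `π` to all orders. -/
theorem pow_dvd_pow_map_sub_of_dvd (hp : p.Prime) (hp3 : 3 ≤ p) (hπ : π ≠ 0) (hu : IsUnit u)
    (hpN : (p : A) = u * π ^ p ^ k) {j : ℕ} (hj : j < k) (f : A →+* A)
    (res : ∀ x, ∃ a, f a = a ∧ π ∣ x - a) (hf : (f ^ p ^ (j + 1)) π = π)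
    (h : π ^ (2 + ∑ i ∈ Finset.range (k - j), p ^ i) ∣ f π - π) (t : ℕ) :
    π ^ t ∣ (f ^ p ^ j) π - π := by
  induction j generalizing f with
  | zero =>
    have h0 : (∑ i ∈ Finset.range k, p ^ i + 1) + 1 = 2 + ∑ i ∈ Finset.range k, p ^ i := by omega
    rw [Nat.sub_zero, ← h0] at h
    rw [zero_add, pow_one, RingHom.coe_pow] at hf
    have := pow_dvd_map_sub_of_iterate_prime_eq hp hπ hu hpN f res (by omega) h hf
      (by rw [mul_add]; have := mul_geom_sum_add_one p k; omega) t
    rw [pow_zero, pow_one]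
    exact (pow_dvd_pow π (by omega)).trans this
  | succ j ih =>
    have hres : ∀ x, ∃ a, (f ^ p) a = a ∧ π ∣ x - a := fun x => by
      obtain ⟨a, ha, hx⟩ := res x
      exact ⟨a, fixed_pow ha _, hx⟩
    obtain ⟨m, rfl⟩ : ∃ m, k = m + (j + 1) := ⟨k - (j + 1), by omega⟩
    have e : m + (j + 1) - j = m + 1 := by omega
    rw [Nat.add_sub_cancel] at h
    have h0 : (∑ i ∈ Finset.range m, p ^ i + 1) + 1 = 2 + ∑ i ∈ Finset.range m, p ^ i := by omega
    rw [← h0] at h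
    have hle : p ^ m ≤ p ^ (m + (j + 1)) := Nat.pow_le_pow_right hp.pos (by omega)
    have h2 := pow_dvd_iterate_prime_sub_of_le_mul hp (Dvd.intro_left u hpN.symm) f res
      (by omega) h (m := 2 + ∑ i ∈ Finset.range (m + 1), p ^ i)
      (by rw [Finset.sum_range_succ]; omega) (by rw [geom_sum_succ, mul_add]; omega)
    have h3 := ih (by omega) (f ^ p) hres (by rw [← pow_mul, ← pow_succ', hf])
      (by rw [e, RingHom.coe_pow]; exact h2)
    rwa [← pow_mul, ← pow_succ'] at h3

end Order

section Residue

/-- A nonzero family can be divided by a power of `p` so that some entry is not divisible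
by `p`. -/
theorem exists_eq_pow_mul_not_dvd {R ι : Type*} [CommRing R] [IsDomain R] [WfDvdMonoid R] {p : R}
    (hp : ¬IsUnit p) {g : ι → R} {i₀ : ι} (h0 : g i₀ ≠ 0) :
    ∃ (m : ℕ) (g' : ι → R), (∀ i, g i = p ^ m * g' i) ∧ ∃ i, ¬p ∣ g' i := by
  classical
  have hex : ∃ n, ¬∀ i, p ^ n ∣ g i := by
    obtain ⟨n, hn⟩ := FiniteMultiplicity.of_not_isUnit hp h0
    exact ⟨n + 1, fun H => hn (H i₀)⟩
  obtain ⟨m, hm⟩ : ∃ m, Nat.find hex = m + 1 :=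
    Nat.exists_eq_succ_of_ne_zero fun h =>
      Nat.find_spec hex fun i => by rw [h, pow_zero]; exact one_dvd _
  have hdvd : ∀ i, p ^ m ∣ g i := not_not.mp (Nat.find_min hex (by omega : m < Nat.find hex))
  choose g' hg' using hdvd
  refine ⟨m, g', hg', ?_⟩
  by_contra! H
  refine Nat.find_spec hex fun i => ?_
  rw [hm, hg' i, pow_succ]
  exact mul_dvd_mul_left _ (H i)

variable {R A : Type*} [CommRing R] [CommRing A] [IsDomain A]

/-- If `p` generates the maximal ideal of `R`, `p` is a unit times `π ^ N` in `A`, and any `2 * N`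
elements of `A` satisfy a primitive linear relation over `R`, then `R` surjects onto the residue
ring of `A`. -/
theorem exists_dvd_sub_map (φ : R →+* A) {p : ℕ} (hR : ∀ x : R, ¬IsUnit x → (p : R) ∣ x)
    {π : A} (hπ : π ≠ 0) (hπu : ¬IsUnit π) {N : ℕ} (hN : N ≠ 0) (hpN : π ^ N ∣ (p : A))
    (dep : ∀ v : Fin N ⊕ Fin N → A,
      ∃ g : Fin N ⊕ Fin N → R, ∑ i, φ (g i) * v i = 0 ∧ ∃ i, ¬(p : R) ∣ g i)
    (x : A) : ∃ a, π ∣ x - φ a := by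
  classical
  by_contra! hx
  have hpφ : ∀ a, (p : R) ∣ a → π ^ N ∣ φ a := fun a ha =>
    hpN.trans (by simpa using map_dvd φ ha)
  obtain ⟨g, hg, hprim⟩ := dep (Sum.elim (fun j => π ^ (j : ℕ)) (fun j => x * π ^ (j : ℕ)))
  set c : Fin N → A := fun j => φ (g (.inl j)) + φ (g (.inr j)) * x with hc
  have hsum : ∑ j, c j * π ^ (j : ℕ) = 0 := by
    rw [← hg, Fintype.sum_sum_type, ← Finset.sum_add_distrib]
    refine Finset.sum_congr rfl fun j _ => ?_
    simp only [hc, Sum.elim_inl, Sum.elim_inr]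
    ring
  have hprimitive : ∀ j, ¬((p : R) ∣ g (.inl j) ∧ (p : R) ∣ g (.inr j)) → ¬π ∣ c j := by
    intro j hj hdvd
    by_cases hb : (p : R) ∣ g (.inr j)
    · have ha : IsUnit (g (.inl j)) := by
        by_contra H
        exact hj ⟨hR _ H, hb⟩
      have h1 : π ∣ φ (g (.inl j)) := by
        have h2 := ((dvd_pow_self π hN).trans (hpφ _ hb)).mul_right x
        exact (dvd_add_left h2).mp hdvd
      exact hπu (isUnit_of_dvd_unit h1 (ha.map φ))
    · obtain ⟨b, hb⟩ : IsUnit (g (.inr j)) := by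
        by_contra H
        exact hb (hR _ H)
      refine hx (-(g (.inl j) * ↑b⁻¹)) ?_
      have hinv : φ ↑b⁻¹ * φ (g (.inr j)) = 1 := by rw [← hb, ← map_mul]; simp
      convert hdvd.mul_left (φ ↑b⁻¹) using 1
      simp only [hc, map_neg, map_mul]
      linear_combination -x * hinv
  have hex : ∃ n, ∃ h : n < N, ¬π ∣ c ⟨n, h⟩ := by
    obtain ⟨i, hi⟩ := hprim
    rcases i with j | j
    · exact ⟨j, j.2, hprimitive j fun H => hi H.1⟩
    · exact ⟨j, j.2, hprimitive j fun H => hi H.2⟩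
  obtain ⟨hn, hcn⟩ := Nat.find_spec hex
  set n := Nat.find hex
  have hrest : π ^ (n + 1) ∣ ∑ j ∈ Finset.univ.erase ⟨n, hn⟩, c j * π ^ (j : ℕ) := by
    refine Finset.dvd_sum fun j hj => ?_
    have hjn : (j : ℕ) ≠ n := fun H => (Finset.mem_erase.mp hj).1 (Fin.ext H)
    rcases lt_or_gt_of_ne hjn with hlt | hgt
    · have h1 : π ∣ c j := by
        by_contra H
        exact Nat.find_min hex hlt ⟨j.2, H⟩
      have h2 : (p : R) ∣ g (.inl j) ∧ (p : R) ∣ g (.inr j) := by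
        by_contra H
        exact hprimitive j H h1
      have h3 : π ^ N ∣ c j := (hpφ _ h2.1).add ((hpφ _ h2.2).mul_right x)
      exact ((pow_dvd_pow π hn).trans h3).mul_right _
    · exact (pow_dvd_pow π hgt).mul_left _
  rw [← Finset.add_sum_erase _ _ (Finset.mem_univ (⟨n, hn⟩ : Fin N))] at hsum
  have h4 : π ^ (n + 1) ∣ c ⟨n, hn⟩ * π ^ n := (dvd_add_left hrest).mp (hsum ▸ dvd_zero _)
  rw [pow_succ', mul_dvd_mul_iff_right (pow_ne_zero _ hπ)] at h4
  exact hcn h4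

/-- Primitive linear relations over `R` among more than `[L : K]` elements of `L`. -/
theorem exists_primitive_relation {K L ι : Type*} [Field K] [Field L] [Algebra K L]
    [FiniteDimensional K L] [IsDomain R] [WfDvdMonoid R] [Algebra R K] [IsFractionRing R K]
    {p : R} (hp : ¬IsUnit p) (hp0 : p ≠ 0) [Fintype ι]
    (hι : Module.finrank K L < Fintype.card ι) (v : ι → L) :
    ∃ g : ι → R, ∑ i, algebraMap K L (algebraMap R K (g i)) * v i = 0 ∧ ∃ i, ¬p ∣ g i := by
  have hdep : ¬LinearIndependent K v := fun H => hι.not_ge H.fintype_card_le_finrank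
  obtain ⟨g, hg, i₀, hi₀⟩ := Fintype.not_linearIndependent_iff.mp hdep
  obtain ⟨b, hb⟩ := IsLocalization.exist_integer_multiples (nonZeroDivisors R) Finset.univ g
  choose h hh using fun i => hb i (Finset.mem_univ i)
  have hb0 : algebraMap R K b ≠ 0 := by simp
  have hi₀' : h i₀ ≠ 0 := by
    intro H
    have := hh i₀
    rw [H, map_zero, Algebra.smul_def, eq_comm, mul_eq_zero] at this
    exact this.elim hb0 hi₀
  obtain ⟨m, g', hg', hprim⟩ := exists_eq_pow_mul_not_dvd hp hi₀'
  refine ⟨g', ?_, hprim⟩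
  have hpm : algebraMap K L (algebraMap R K (p ^ m)) ≠ 0 := by
    simpa using fun H => absurd H hp0
  refine (mul_eq_zero_iff_left hpm).mp ?_
  have hsum : algebraMap K L (algebraMap R K b) * ∑ i, g i • v i = 0 := by rw [hg, mul_zero]
  rw [← hsum, Finset.mul_sum, Finset.mul_sum]
  refine Finset.sum_congr rfl fun i _ => ?_
  rw [Algebra.smul_def, ← mul_assoc, ← mul_assoc, ← map_mul, ← map_mul, ← map_mul, ← hg', hh,
    Algebra.smul_def]

end Residue

section Galois

theorem eq_zero_of_forall_pow_dvd {A : Type*} [CommRing A] [IsDomain A] [WfDvdMonoid A] {π x : A}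
    (hπu : ¬IsUnit π) (h : ∀ t : ℕ, π ^ t ∣ x) : x = 0 := by
  by_contra hx
  obtain ⟨n, hn⟩ := FiniteMultiplicity.of_not_isUnit hπu hx
  exact hn (h _)

theorem exists_pow_eq_of_orderOf_eq {G : Type*} [Group G] [IsCyclic G] {p k j : ℕ}
    (hp : p.Prime) (hG : Nat.card G = p ^ k) {σ : G} (hσ : orderOf σ = p ^ j) :
    ∃ g : G, g ^ p ^ (k - j) = σ := by
  have : Finite G := Nat.finite_of_card_ne_zero (by rw [hG]; exact pow_ne_zero _ hp.ne_zero)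
  have hj : j ≤ k := (Nat.pow_dvd_pow_iff_le_right hp.one_lt).mp (by
    rw [← hσ, ← hG]
    exact orderOf_dvd_natCard σ)
  obtain ⟨g, hg⟩ := IsCyclic.exists_generator (α := G)
  obtain ⟨n, rfl⟩ := mem_powers_iff_mem_zpowers.mpr (hg σ)
  have hgo : orderOf g = p ^ k := by rw [← hG]; exact orderOf_eq_card_of_forall_mem_zpowers hg
  have h1 : p ^ k ∣ n * p ^ j := by
    rw [← hgo]
    apply orderOf_dvd_of_pow_eq_one
    rw [pow_mul, ← hσ]
    exact pow_orderOf_eq_one _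
  obtain ⟨m, hm⟩ : p ^ (k - j) ∣ n := by
    rw [← Nat.sub_add_cancel hj, pow_add] at h1
    exact Nat.dvd_of_mul_dvd_mul_right (pow_pos hp.pos j) h1
  exact ⟨g ^ m, by simp only [hm]; rw [← pow_mul, mul_comm]⟩

/-- The ramification numbers of a faithful action of a cyclic group of order `p ^ k` when `p` is a
unit times `π ^ p ^ k`. -/
theorem exists_isUnit_map_sub_eq {A : Type*} [CommRing A] [IsDomain A] [WfDvdMonoid A] {π u : A}
    {p k : ℕ} (hp : p.Prime) (hp3 : 3 ≤ p) (hπ : π ≠ 0) (hπu : ¬IsUnit π)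
    (hmax : ∀ x, ¬IsUnit x → π ∣ x) (hu : IsUnit u) (hpN : (p : A) = u * π ^ p ^ k)
    {G : Type*} [Group G] [IsCyclic G] (hG : Nat.card G = p ^ k) (ρ : G →* (A →+* A))
    (hρ : ∀ σ, (∀ x, ρ σ x = x) → σ = 1) (res : ∀ x, ∃ a, (∀ σ, ρ σ a = a) ∧ π ∣ x - a)
    {σ : G} (hσ1 : σ ≠ 1) {j : ℕ} (hσ : orderOf σ = p ^ j) :
    ∃ v, IsUnit v ∧ ρ σ π - π = v * π ^ (1 + ∑ i ∈ Finset.range (k - j + 1), p ^ i) := by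
  have hj : j ≤ k := (Nat.pow_dvd_pow_iff_le_right hp.one_lt).mp (by
    rw [← hσ, ← hG]
    exact orderOf_dvd_natCard σ)
  have hρres : ∀ σ, ∀ x, ∃ a, ρ σ a = a ∧ π ∣ x - a := fun σ x => by
    obtain ⟨a, ha, hx⟩ := res x
    exact ⟨a, ha σ, hx⟩
  obtain ⟨i, rfl⟩ : ∃ i, j = i + 1 := Nat.exists_eq_succ_of_ne_zero fun h => hσ1 (by
    rw [← orderOf_eq_one_iff, hσ, h, pow_zero])
  obtain ⟨g, rfl⟩ := exists_pow_eq_of_orderOf_eq hp hG hσ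
  set σ := g ^ p ^ (k - (i + 1)) with hgσ
  have hlow := pow_dvd_pow_map_sub hp hπ hπu hmax (Dvd.intro_left u hpN.symm) (ρ g) (hρres g)
    (by rw [← map_pow, ← hG, pow_card_eq_one', map_one]; rfl)
    (by omega : k - (i + 1) < k)
  rw [← map_pow, ← hgσ] at hlow
  obtain ⟨v, hv⟩ := hlow
  refine ⟨v, ?_, by rw [hv, mul_comm]⟩
  by_contra hvu
  have hup := pow_dvd_pow_map_sub_of_dvd hp hp3 hπ hu hpN (by omega : i < k) (ρ σ) (hρres σ)
    (by rw [← map_pow, ← hσ, pow_orderOf_eq_one, map_one]; rfl)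
    (by
      obtain ⟨w, rfl⟩ := hmax v hvu
      refine ⟨w, ?_⟩
      rw [hv, (by omega : k - i = k - (i + 1) + 1)]
      ring)
  rw [← map_pow] at hup
  have h1 : σ ^ p ^ i = 1 := hρ _ fun x => sub_eq_zero.mp <|
    eq_zero_of_forall_pow_dvd hπu fun t => (pow_dvd_pow π t.le_succ).trans
      (pow_dvd_map_sub _ (hρres _) (hup (t + 1)) x)
  have h2 := orderOf_dvd_of_pow_eq_one h1
  rw [hσ, Nat.pow_dvd_pow_iff_le_right hp.one_lt] at h2
  omega

/-- The action of the Galois group on the integral closure of a subring of the base field. -/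
noncomputable def galoisAction (R K L : Type*) [CommRing R] [Field K] [Field L] [Algebra R K]
    [Algebra R L] [Algebra K L] [IsScalarTower R K L] :
    (L ≃ₐ[K] L) →* (integralClosure R L →+* integralClosure R L) where
  toFun σ := ((σ.restrictScalars R).mapIntegralClosure : integralClosure R L →+* _)
  map_one' := rfl
  map_mul' _ _ := rfl

/-- Summing a function of the order exponent over a cyclic group of order `p ^ k`. -/
theorem sum_orderOf_log {G : Type*} [Group G] [IsCyclic G] [Fintype G] [DecidableEq G] {p k : ℕ}
    (hp : p.Prime) (hG : Nat.card G = p ^ k) (F : ℕ → ℕ) :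
    ∑ σ ∈ Finset.univ.filter (fun σ : G => σ ≠ 1), F (Nat.log p (orderOf σ)) =
      ∑ j ∈ Finset.Icc 1 k, (p ^ j).totient * F j := by
  have hord : ∀ σ : G, ∃ j ≤ k, orderOf σ = p ^ j := fun σ =>
    (Nat.dvd_prime_pow hp).mp (hG ▸ orderOf_dvd_natCard σ)
  have hmaps : ∀ σ ∈ Finset.univ.filter (fun σ : G => σ ≠ 1),
      Nat.log p (orderOf σ) ∈ Finset.Icc 1 k := by
    intro σ hσ
    obtain ⟨j, hj, hσj⟩ := hord σ
    rw [hσj, Nat.log_pow hp.one_lt, Finset.mem_Icc]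
    refine ⟨Nat.one_le_iff_ne_zero.mpr fun h => (Finset.mem_filter.mp hσ).2 ?_, hj⟩
    rw [← orderOf_eq_one_iff, hσj, h, pow_zero]
  rw [← Finset.sum_fiberwise_of_maps_to hmaps]
  refine Finset.sum_congr rfl fun j hj => ?_
  rw [Finset.mem_Icc] at hj
  have hfiber : (Finset.univ.filter (fun σ : G => σ ≠ 1)).filter
      (fun σ => Nat.log p (orderOf σ) = j) = Finset.univ.filter (fun σ : G => orderOf σ = p ^ j) := by
    ext σ
    simp only [Finset.mem_filter, Finset.mem_univ, true_and]
    constructor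
    · rintro ⟨-, h⟩
      obtain ⟨i, -, hi⟩ := hord σ
      rw [hi, Nat.log_pow hp.one_lt] at h
      rw [hi, h]
    · intro h
      refine ⟨?_, by rw [h, Nat.log_pow hp.one_lt]⟩
      rintro rfl
      rw [orderOf_one] at h
      exact (Nat.one_lt_pow (by omega) hp.one_lt).ne h
  rw [Finset.sum_congr rfl (g := fun _ => F j) fun σ hσ => by rw [(Finset.mem_filter.mp hσ).2],
    Finset.sum_const, hfiber, smul_eq_mul]
  congr 1
  apply IsCyclic.card_orderOf_eq_totient
  rw [← Nat.card_eq_fintype_card, hG]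
  exact pow_dvd_pow p hj.2

theorem sum_totient_mul_eq {p k : ℕ} (hp : p.Prime) (hk : k = 2 ∨ k = 3) :
    ∑ j ∈ Finset.Icc 1 k, (p ^ j).totient * (1 + ∑ i ∈ Finset.range (k - j + 1), p ^ i) =
      (k + 1) * p ^ k - (∑ i ∈ Finset.range k, p ^ i) - 1 := by
  obtain ⟨q, rfl⟩ : ∃ q, p = q + 1 := ⟨p - 1, by have := hp.pos; omega⟩
  rw [Nat.sub_sub, eq_comm]
  apply Nat.sub_eq_of_eq_add
  rcases hk with rfl | rfl
  · rw [show Finset.Icc 1 2 = {1, 2} from rfl]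
    simp [Finset.sum_range_succ, Nat.totient_prime_pow hp, Nat.totient_prime hp]
    ring
  · rw [show Finset.Icc 1 3 = {1, 2, 3} from rfl]
    simp [Finset.sum_range_succ, Nat.totient_prime_pow hp, Nat.totient_prime hp]
    ring

end Galois

end TotallyRamified

/-- Let `K` be a finite unramified extension of `ℚ_p` (`p` an odd prime) and
`L/K` a totally ramified cyclic Galois extension of degree `p^k`, `k = 2` or `k = 3`.  Then for
every uniformizer `π` of `L` (i.e. generator of the maximal ideal of the ring of integers of `L`)
and every `σ ∈ Gal(L/K)` with `σ ≠ 1` of order `p^j` one has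
`v_L(σ(π) − π) = 1 + (1 + p + ⋯ + p^{k-j})`; i.e. the lower ramification jumps are `1, p+1`
(resp. `1, p+1, p²+p+1`).  Consequently `v_L(𝒟_{L/K}) = ∑_{σ≠1} v_L(σ(π)−π)` equals
`3p²−p−2` (resp. `4p³−p²−p−2`), i.e. `(k+1)p^k − (1+p+⋯+p^{k-1}) − 1`. -/
theorem stmt8 (p : ℕ) [Fact (Nat.Prime p)] (hodd : Odd p)
    (K : Type) [Field K] [Algebra ℚ_[p] K] [FiniteDimensional ℚ_[p] K]
    -- `K/ℚ_p` is unramified: `p` generates the maximal ideal of the ring of integers of `K`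
    (hKloc : ∀ x : integralClosure ℤ_[p] K, ¬IsUnit x → (p : integralClosure ℤ_[p] K) ∣ x)
    (hKp : ¬IsUnit (p : integralClosure ℤ_[p] K))
    (k : ℕ) (hk : k = 2 ∨ k = 3)
    (L : Type) [Field L] [Algebra ℚ_[p] L] [Algebra K L] [IsScalarTower ℚ_[p] K L]
    [FiniteDimensional K L] [IsGalois K L]
    (hcyc : IsCyclic (L ≃ₐ[K] L)) (hdeg : Module.finrank K L = p ^ k)
    -- `L/K` is totally ramified: `v_L(p) = p^k`
    (htr : ∃ π₀ : integralClosure ℤ_[p] L,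
      (¬IsUnit π₀ ∧ ∀ x : integralClosure ℤ_[p] L, ¬IsUnit x → π₀ ∣ x) ∧
      ∃ u : integralClosure ℤ_[p] L, IsUnit u ∧ (p : integralClosure ℤ_[p] L) = u * π₀ ^ p ^ k) :
    ∀ π : integralClosure ℤ_[p] L,
      (¬IsUnit π ∧ ∀ x : integralClosure ℤ_[p] L, ¬IsUnit x → π ∣ x) →
      (∀ σ : L ≃ₐ[K] L, σ ≠ 1 → ∀ j : ℕ, orderOf σ = p ^ j →
        ∃ u : integralClosure ℤ_[p] L, IsUnit u ∧
          σ (π : L) - (π : L) =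
            ((u * π ^ (1 + ∑ i ∈ Finset.range (k - j + 1), p ^ i) :
              integralClosure ℤ_[p] L) : L)) ∧
      (∃ m : (L ≃ₐ[K] L) → ℕ,
        (∀ σ : L ≃ₐ[K] L, σ ≠ 1 →
          ∃ u : integralClosure ℤ_[p] L, IsUnit u ∧
            σ (π : L) - (π : L) = ((u * π ^ m σ : integralClosure ℤ_[p] L) : L)) ∧
        (∑ σ ∈ Finset.univ.filter (fun σ : L ≃ₐ[K] L => σ ≠ 1), m σ) =
          (k + 1) * p ^ k - (∑ i ∈ Finset.range k, p ^ i) - 1) := by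
  have hp : p.Prime := Fact.out
  have hp3 : 3 ≤ p := by
    have h2 := hp.two_le
    rcases hodd with ⟨m, rfl⟩
    omega
  have hN : p ^ k ≠ 0 := pow_ne_zero _ hp.ne_zero
  have : IsScalarTower ℤ_[p] ℚ_[p] K := .of_algebraMap_eq fun _ => rfl
  have : IsScalarTower ℤ_[p] ℚ_[p] L := .of_algebraMap_eq fun _ => rfl
  have : IsScalarTower ℤ_[p] K L := .of_algebraMap_eq fun x =>
    IsScalarTower.algebraMap_apply ℚ_[p] K L (algebraMap ℤ_[p] ℚ_[p] x)
  have : FiniteDimensional ℚ_[p] L := .trans ℚ_[p] K L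
  have : CharZero K := charZero_of_injective_algebraMap (algebraMap ℚ_[p] K).injective
  have : CharZero L := charZero_of_injective_algebraMap (algebraMap ℚ_[p] L).injective
  have : IsNoetherianRing (integralClosure ℤ_[p] K) :=
    IsIntegralClosure.isNoetherianRing ℤ_[p] ℚ_[p] K _
  have : IsNoetherianRing (integralClosure ℤ_[p] L) :=
    IsIntegralClosure.isNoetherianRing ℤ_[p] ℚ_[p] L _
  have : IsFractionRing (integralClosure ℤ_[p] K) K :=
    integralClosure.isFractionRing_of_finite_extension ℚ_[p] K
  have hpK : (p : integralClosure ℤ_[p] K) ≠ 0 := by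
    intro h
    exact hp.ne_zero (by exact_mod_cast congrArg (algebraMap (integralClosure ℤ_[p] K) K) h)
  have hpL : (p : integralClosure ℤ_[p] L) ≠ 0 := by
    intro h
    exact hp.ne_zero (by exact_mod_cast congrArg (algebraMap (integralClosure ℤ_[p] L) L) h)
  rintro π ⟨hπu, hmax⟩
  obtain ⟨u, hu, hpN⟩ : ∃ u, IsUnit u ∧ (p : integralClosure ℤ_[p] L) = u * π ^ p ^ k := by
    obtain ⟨π₀, ⟨hπ₀u, hmax₀⟩, u, hu, hpu⟩ := htr
    obtain ⟨w, hw⟩ := associated_of_dvd_dvd (hmax _ hπ₀u) (hmax₀ _ hπu)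
    exact ⟨u * w ^ p ^ k, hu.mul (w.isUnit.pow _), by rw [hpu, ← hw]; ring⟩
  have hπ : π ≠ 0 := by
    rintro rfl
    rw [zero_pow hN, mul_zero] at hpN
    exact hpL hpN
  let φ : integralClosure ℤ_[p] K →+* integralClosure ℤ_[p] L :=
    (IsScalarTower.toAlgHom ℤ_[p] K L).mapIntegralClosure
  have hG : Nat.card (L ≃ₐ[K] L) = p ^ k := by rw [IsGalois.card_aut_eq_finrank, hdeg]
  have hsurj := TotallyRamified.exists_dvd_sub_map φ hKloc hπ hπu hN
    (Dvd.intro_left u hpN.symm) fun v => by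
      obtain ⟨g, hg, hprim⟩ := TotallyRamified.exists_primitive_relation (K := K) (L := L) hKp hpK
        (by
          rw [hdeg, Fintype.card_sum, Fintype.card_fin]
          omega)
        (fun i => (v i : L))
      refine ⟨g, Subtype.ext ?_, hprim⟩
      rw [AddSubmonoidClass.coe_finsetSum]
      exact hg
  have hmain : ∀ σ : L ≃ₐ[K] L, σ ≠ 1 → ∀ j : ℕ, orderOf σ = p ^ j →
      ∃ v : integralClosure ℤ_[p] L, IsUnit v ∧ σ (π : L) - (π : L) =
        ((v * π ^ (1 + ∑ i ∈ Finset.range (k - j + 1), p ^ i) :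
          integralClosure ℤ_[p] L) : L) := by
    intro σ hσ1 j hσ
    have hfaithful : ∀ τ, (∀ x, TotallyRamified.galoisAction ℤ_[p] K L τ x = x) → τ = 1 := by
      intro τ hτ
      refine AlgEquiv.ext fun x => ?_
      have : IsFractionRing (integralClosure ℤ_[p] L) L :=
        integralClosure.isFractionRing_of_finite_extension ℚ_[p] L
      obtain ⟨a, b, -, rfl⟩ := IsFractionRing.div_surjective (A := integralClosure ℤ_[p] L) x
      have hfix : ∀ y : integralClosure ℤ_[p] L, τ (y : L) = y := fun y =>
        congrArg Subtype.val (hτ y)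
      rw [map_div₀]
      exact congrArg₂ _ (hfix a) (hfix b)
    have hres : ∀ x, ∃ a, (∀ τ, TotallyRamified.galoisAction ℤ_[p] K L τ a = a) ∧ π ∣ x - a := by
      intro x
      obtain ⟨a, ha⟩ := hsurj x
      exact ⟨φ a, fun τ => Subtype.ext (τ.commutes _), ha⟩
    obtain ⟨v, hv, h⟩ := TotallyRamified.exists_isUnit_map_sub_eq hp hp3 hπ hπu hmax hu hpN hG
      (TotallyRamified.galoisAction ℤ_[p] K L) hfaithful hres hσ1 hσ
    exact ⟨v, hv, congrArg Subtype.val h⟩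
  refine ⟨hmain, fun σ => 1 + ∑ i ∈ Finset.range (k - Nat.log p (orderOf σ) + 1), p ^ i, ?_, ?_⟩
  · intro σ hσ
    obtain ⟨j, -, hj⟩ := (Nat.dvd_prime_pow hp).mp (hG ▸ orderOf_dvd_natCard σ)
    simpa only [hj, Nat.log_pow hp.one_lt] using hmain σ hσ j hj
  · rw [← TotallyRamified.sum_totient_mul_eq hp hk]
    convert TotallyRamified.sum_orderOf_log hp hG
      (fun j => 1 + ∑ i ∈ Finset.range (k - j + 1), p ^ i)
end

section
/- Let n = p² and c = 3 (respectively n = p³ and c = 4). Let f(X) = X^n + f_1X^{n−1} + ⋯ + f_n and g(X) = X^n + g_1X^{n−1} + ⋯ + g_n be Eisenstein polynomials of degree n over K, and suppose the extension of K generated by a root of f is cyclic (Galois with cyclic group of order n). If v_p(f_i − g_i) ≥ c for all 1 ≤ i ≤ n−1 and v_p(f_n − g_n) ≥ c+1, then f and g generate the same extension: inside a fixed algebraic closure of K, for every root π of f there is a root ρ of g with K(ρ) = K(π). In particular the extension generated by g is also cyclic of degree n. -/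
open Polynomial IntermediateField

theorem sum_mul_pow_padicValNat (p : ℕ) [Fact p.Prime] (k : ℕ) :
    ∑ j ∈ Finset.Ico 1 (p ^ k), (p : ℤ) * (p : ℤ) ^ padicValNat p j = k * (p - 1) * p ^ k := by
  have hp : p.Prime := Fact.out
  induction k with
  | zero => simp
  | succ k ih =>
    have hmul : ∑ j ∈ (Finset.Ico 1 (p ^ (k + 1))).filter (p ∣ ·),
        (p : ℤ) * (p : ℤ) ^ padicValNat p j =
        ∑ j ∈ Finset.Ico 1 (p ^ k), (p : ℤ) * ((p : ℤ) * (p : ℤ) ^ padicValNat p j) := by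
      symm
      refine Finset.sum_bij (fun j _ => p * j) ?_ ?_ ?_ ?_
      · intro j hj
        simp only [Finset.mem_Ico, Finset.mem_filter] at hj ⊢
        refine ⟨⟨Nat.mul_pos hp.pos hj.1, ?_⟩, dvd_mul_right _ _⟩
        rw [pow_succ']
        exact Nat.mul_lt_mul_of_pos_left hj.2 hp.pos
      · intro a _ b _ h
        exact Nat.eq_of_mul_eq_mul_left hp.pos h
      · intro b hb
        simp only [Finset.mem_Ico, Finset.mem_filter] at hb
        obtain ⟨⟨h1, h2⟩, c, rfl⟩ := hb
        refine ⟨c, ?_, rfl⟩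
        rw [pow_succ'] at h2
        exact Finset.mem_Ico.mpr ⟨Nat.pos_of_mul_pos_left h1, Nat.lt_of_mul_lt_mul_left h2⟩
      · intro j hj
        have hj0 : j ≠ 0 := by have := (Finset.mem_Ico.mp hj).1; omega
        rw [padicValNat.mul hp.ne_zero hj0, padicValNat_self]
        ring
    have hcop : ∑ j ∈ (Finset.Ico 1 (p ^ (k + 1))).filter (¬p ∣ ·),
        (p : ℤ) * (p : ℤ) ^ padicValNat p j = (p ^ (k + 1) - p ^ k) * p := by
      rw [Finset.sum_congr rfl (g := fun _ => (p : ℤ))]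
      · rw [Finset.sum_const, nsmul_eq_mul]
        congr 1
        have : (Finset.Ico 1 (p ^ (k + 1))).filter (¬p ∣ ·) =
            (Finset.range (p ^ (k + 1))).filter (fun j => (p ^ (k + 1)).Coprime j) := by
          ext j
          simp only [Finset.mem_filter, Finset.mem_Ico, Finset.mem_range,
            Nat.coprime_pow_left_iff (Nat.succ_pos k), hp.coprime_iff_not_dvd]
          refine ⟨fun h => ⟨h.1.2, h.2⟩, fun h => ⟨⟨?_, h.1⟩, h.2⟩⟩
          rcases Nat.eq_zero_or_pos j with rfl | h'
          · exact absurd (dvd_zero p) h.2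
          · exact h'
        rw [this]
        change ((Nat.totient (p ^ (k + 1)) : ℕ) : ℤ) = _
        rw [Nat.totient_prime_pow_succ hp, Nat.cast_mul, Nat.cast_sub hp.one_le]
        push_cast
        ring
      · intro j hj
        rw [padicValNat.eq_zero_of_not_dvd (Finset.mem_filter.mp hj).2]
        simp
    rw [← Finset.sum_filter_add_sum_filter_not _ (p ∣ ·), hmul, hcop, ← Finset.mul_sum, ih]
    push_cast
    ring

section Ultrametric

variable {L : Type*} [Field L] {v : AbsoluteValue L ℝ} {π : L} {r : ℝ}

/-- Terms whose absolute values lie in different classes modulo `d` cannot cancel. -/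
theorem exists_apply_sum_mul_pow_eq (hv : IsNonarchimedean v) (hr : 0 < r) (hr1 : r < 1)
    (hπ : v π = r) {d : ℕ} (hd : 0 < d) (a : ℕ → L)
    (ha : ∀ i < d, a i ≠ 0 → ∃ b : ℤ, v (a i) = r ^ ((d : ℤ) * b)) :
    ∃ j < d, v (∑ i ∈ Finset.range d, a i * π ^ i) = v (a j * π ^ j) ∧
      ∀ i < d, v (a i * π ^ i) ≤ v (a j * π ^ j) := by
  obtain ⟨j, hj, hmax⟩ := Finset.exists_max_image (Finset.range d) (fun i => v (a i * π ^ i))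
    ⟨0, Finset.mem_range.mpr hd⟩
  simp only [Finset.mem_range] at hj hmax
  refine ⟨j, hj, ?_, hmax⟩
  by_cases h0 : v (a j * π ^ j) = 0
  · rw [Finset.sum_eq_zero, map_zero, h0]
    intro i hi
    have := hmax i (Finset.mem_range.mp hi)
    rw [h0] at this
    exact v.eq_zero.mp (le_antisymm this (v.nonneg _))
  · refine hv.apply_sum_eq_of_lt (fun x => (v.map_neg x).symm) (Finset.mem_range.mpr hj) ?_
    intro i hi hij
    rw [Finset.mem_range] at hi
    refine lt_of_le_of_ne (hmax i hi) fun heq => hij ?_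
    have key : ∀ k < d, v (a k * π ^ k) ≠ 0 →
        ∃ b : ℤ, v (a k * π ^ k) = r ^ ((d : ℤ) * b + k) := by
      intro k hk hk0
      obtain ⟨b, hb⟩ := ha k hk (by rintro h; simp [h] at hk0)
      exact ⟨b, by rw [map_mul, map_pow, hb, hπ, zpow_add₀ hr.ne', zpow_natCast]⟩
    obtain ⟨b, hb⟩ := key i hi (heq ▸ h0)
    obtain ⟨c, hc⟩ := key j hj h0
    rw [hb, hc] at heq
    have := zpow_right_injective₀ hr hr1.ne heq
    have h1 : ((d : ℤ) * b + i) % d = ((d : ℤ) * c + j) % d := by rw [this]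
    rw [Int.mul_add_emod_self_left, Int.mul_add_emod_self_left, Int.emod_eq_of_lt (by omega) (by omega),
      Int.emod_eq_of_lt (by omega) (by omega)] at h1
    exact_mod_cast h1

end Ultrametric

/-- `π` generates `L` over `K` and has absolute value `r`, while the nonzero elements of `K` have
absolute values in `r ^ (n ℤ)` with `n` the number of powers of `π` needed to span `L`. -/
structure IsTotRamGenerator (K : Type*) {L : Type*} [Field K] [Field L] [Algebra K L]
    (v : AbsoluteValue L ℝ) (π : L) (r : ℝ) (n : ℕ) : Prop where
  nonarch : IsNonarchimedean v
  pos : 0 < r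
  lt_one : r < 1
  map_gen : v π = r
  pos_degree : 0 < n
  base : ∀ a : K, a ≠ 0 → ∃ b : ℤ, v (algebraMap K L a) = r ^ ((n : ℤ) * b)
  expand : ∀ x : L, ∃ a : ℕ → K, x = ∑ i ∈ Finset.range n, algebraMap K L (a i) * π ^ i
  invariant : ∀ (σ : L ≃ₐ[K] L) (x : L), v (σ x) = v x

namespace IsTotRamGenerator

variable {K L : Type*} [Field K] [Field L] [Algebra K L]
  {v : AbsoluteValue L ℝ} {π : L} {r : ℝ} {n : ℕ}

theorem exists_expand (h : IsTotRamGenerator K v π r n) (x : L) :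
    ∃ a : ℕ → K, x = ∑ i ∈ Finset.range n, algebraMap K L (a i) * π ^ i ∧
      ∃ j < n, v x = v (algebraMap K L (a j) * π ^ j) ∧
        ∀ i < n, v (algebraMap K L (a i) * π ^ i) ≤ v x := by
  obtain ⟨a, ha⟩ := h.expand x
  obtain ⟨j, hj, hs, hmax⟩ := exists_apply_sum_mul_pow_eq h.nonarch h.pos h.lt_one h.map_gen
    h.pos_degree (fun i => algebraMap K L (a i))
    (fun i _ hi => h.base (a i) (by rintro h0; simp [h0] at hi))
  rw [← ha] at hs
  exact ⟨a, ha, j, hj, hs, hs ▸ hmax⟩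

theorem exists_zpow (h : IsTotRamGenerator K v π r n) {x : L} (hx : x ≠ 0) :
    ∃ b : ℤ, v x = r ^ b := by
  obtain ⟨a, -, j, -, hj, -⟩ := h.exists_expand x
  have h0 : a j ≠ 0 := by
    intro h0
    rw [h0, map_zero, zero_mul, map_zero] at hj
    exact hx (v.eq_zero.mp hj)
  obtain ⟨b, hb⟩ := h.base _ h0
  exact ⟨n * b + j, by rw [hj, map_mul, map_pow, hb, h.map_gen, zpow_add₀ h.pos.ne', zpow_natCast]⟩

theorem eq_one_of_fixed (h : IsTotRamGenerator K v π r n) {σ : L ≃ₐ[K] L} (hσ : σ π = π) :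
    σ = 1 := by
  ext x
  obtain ⟨a, ha⟩ := h.expand x
  rw [ha]
  simp [hσ]

theorem apply_sub_le (h : IsTotRamGenerator K v π r n) {σ : L ≃ₐ[K] L} {s : ℝ} (hs : 0 ≤ s)
    (hσ : v (σ π - π) ≤ s * r) (x : L) : v (σ x - x) ≤ s * v x := by
  have hpow : ∀ i : ℕ, v (σ π ^ i - π ^ i) ≤ s * r ^ i := by
    intro i
    induction i with
    | zero => simpa using hs
    | succ i ih =>
      have : σ π ^ (i + 1) - π ^ (i + 1) = (σ π ^ i - π ^ i) * σ π + π ^ i * (σ π - π) := by ring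
      rw [this]
      refine (h.nonarch _ _).trans (max_le ?_ ?_)
      · rw [map_mul, h.invariant, h.map_gen, pow_succ, ← mul_assoc]
        exact mul_le_mul_of_nonneg_right ih h.pos.le
      · rw [map_mul, map_pow, h.map_gen, pow_succ]
        calc r ^ i * v (σ π - π) ≤ r ^ i * (s * r) :=
              mul_le_mul_of_nonneg_left hσ (pow_nonneg h.pos.le i)
          _ = s * (r ^ i * r) := by ring
  obtain ⟨a, ha, -, -, -, hmax⟩ := h.exists_expand x
  have hsum : σ x - x =
      ∑ i ∈ Finset.range n, algebraMap K L (a i) * (σ π ^ i - π ^ i) := by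
    conv_lhs => rw [ha]
    simp [mul_sub, Finset.sum_sub_distrib]
  obtain ⟨i, hi, hle⟩ := h.nonarch.finset_image_add_of_nonempty
    (fun i => algebraMap K L (a i) * (σ π ^ i - π ^ i)) (Finset.nonempty_range_iff.mpr h.pos_degree.ne')
  rw [hsum]
  refine hle.trans ?_
  rw [map_mul]
  calc v (algebraMap K L (a i)) * v (σ π ^ i - π ^ i)
      ≤ v (algebraMap K L (a i)) * (s * r ^ i) := mul_le_mul_of_nonneg_left (hpow i) (v.nonneg _)
    _ = s * v (algebraMap K L (a i) * π ^ i) := by rw [map_mul, map_pow, h.map_gen]; ring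
    _ ≤ s * v x := mul_le_mul_of_nonneg_left (hmax i (Finset.mem_range.mp hi)) hs

theorem apply_pow_prime_sub_le (h : IsTotRamGenerator K v π r n) {p : ℕ} (hp : p.Prime)
    {σ : L ≃ₐ[K] L} {s : ℝ} (hs : 0 ≤ s) (hs1 : s ≤ 1) (hσ : v (σ π - π) ≤ s * r) :
    v ((σ ^ p) π - π) ≤ max (v p * s) (s ^ p) * r := by
  set τ : Module.End K L := (σ : L →ₐ[K] L).toLinearMap - 1 with hτ
  have hτ_apply : ∀ x, τ x = σ x - x := fun x => by simp [hτ]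
  have hτpow : ∀ (j : ℕ) (x : L), v ((τ ^ j) x) ≤ s ^ j * v x := by
    intro j
    induction j with
    | zero => intro x; simp
    | succ j ih =>
      intro x
      rw [pow_succ' τ, Module.End.mul_apply, hτ_apply, pow_succ' s, mul_assoc]
      exact (h.apply_sub_le hs hσ _).trans (mul_le_mul_of_nonneg_left (ih x) hs)
  have hpow : ∀ (k : ℕ) (x : L), (σ ^ k) x = ((τ + 1) ^ k) x := by
    intro k
    induction k with
    | zero => intro x; simp
    | succ k ih =>
      intro x
      rw [pow_succ' σ, pow_succ', AlgEquiv.mul_apply, Module.End.mul_apply, ih]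
      simp [hτ]
  have hexp : (σ ^ p) π - π =
      ∑ j ∈ Finset.range p, (p.choose (j + 1) : L) * (τ ^ (j + 1)) π := by
    rw [hpow, (Commute.one_right τ).add_pow, Finset.sum_range_succ', LinearMap.add_apply]
    simp only [one_pow, mul_one, pow_zero, Nat.choose_zero_right, Nat.cast_one, Module.End.one_apply,
      add_sub_cancel_right, LinearMap.sum_apply]
    refine Finset.sum_congr rfl fun j _ => ?_
    rw [← (Nat.cast_commute (p.choose (j + 1)) (τ ^ (j + 1))).eq, Module.End.mul_apply,
      Module.End.natCast_apply, nsmul_eq_mul]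
  obtain ⟨j, hj, hle⟩ := h.nonarch.finset_image_add_of_nonempty
    (fun j => (p.choose (j + 1) : L) * (τ ^ (j + 1)) π)
    (Finset.nonempty_range_iff.mpr hp.ne_zero)
  rw [hexp]
  refine hle.trans ?_
  rw [map_mul]
  have hj' : j + 1 ≤ p := Finset.mem_range.mp hj
  have hterm := hτpow (j + 1) π
  rw [h.map_gen] at hterm
  rcases hj'.eq_or_lt with heq | hlt
  · rw [heq] at hterm ⊢
    rw [Nat.choose_self, Nat.cast_one, map_one, one_mul]
    exact hterm.trans (mul_le_mul_of_nonneg_right (le_max_right _ _) h.pos.le)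
  · obtain ⟨c, hc⟩ := hp.dvd_choose_self (Nat.succ_ne_zero j) hlt
    rw [hc, Nat.cast_mul, map_mul]
    have hc1 : v (c : L) ≤ 1 := h.nonarch.apply_natCast_le_one
    calc v (p : L) * v (c : L) * v ((τ ^ (j + 1)) π)
        ≤ v (p : L) * 1 * (s * r) := by
          refine mul_le_mul (mul_le_mul_of_nonneg_left hc1 (v.nonneg _))
            (hterm.trans (mul_le_mul_of_nonneg_right ?_ h.pos.le)) (v.nonneg _) (by positivity)
          exact pow_le_of_le_one hs hs1 (Nat.succ_ne_zero j)
      _ = v (p : L) * s * r := by ring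
      _ ≤ _ := mul_le_mul_of_nonneg_right (le_max_left _ _) h.pos.le

theorem apply_pow_sub_le (h : IsTotRamGenerator K v π r n) (σ : L ≃ₐ[K] L) (j : ℕ) :
    v ((σ ^ j) π - π) ≤ v (σ π - π) := by
  induction j with
  | zero => simp
  | succ j ih =>
    have : (σ ^ (j + 1)) π - π = (σ ^ j) (σ π - π) + ((σ ^ j) π - π) := by
      rw [pow_succ, AlgEquiv.mul_apply, map_sub]; ring
    rw [this]
    exact (h.nonarch _ _).trans (max_le (h.invariant _ _).le ih)

end IsTotRamGenerator

theorem prod_zpow_eq_zpow_sum {ι F : Type*} [Field F] {r : F} (hr : r ≠ 0) (s : Finset ι)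
    (t : ι → ℤ) : ∏ j ∈ s, r ^ t j = r ^ ∑ j ∈ s, t j := by
  classical
  induction s using Finset.induction_on with
  | empty => simp
  | insert a s ha ih => rw [Finset.prod_insert ha, Finset.sum_insert ha, ih, zpow_add₀ hr]

namespace IsTotRamGenerator

variable {K L : Type*} [Field K] [Field L] [Algebra K L]
  {v : AbsoluteValue L ℝ} {π : L} {r : ℝ} {n : ℕ}

theorem exists_zpow_of_fixed_pow (h : IsTotRamGenerator K v π r n) {γ : L ≃ₐ[K] L}
    (hfix : ∀ x, γ x = x → x ∈ Set.range (algebraMap K L)) {e d : ℕ} (hn : n = e * d) {x : L}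
    (hx : (γ ^ e) x = x) (hx0 : x ≠ 0) : ∃ b : ℤ, v x = r ^ ((d : ℤ) * b) := by
  obtain ⟨a, ha⟩ := h.exists_zpow hx0
  have hfixed : γ (∏ i ∈ Finset.range e, (γ ^ i) x) = ∏ i ∈ Finset.range e, (γ ^ i) x := by
    have h1 := Finset.prod_range_succ' (fun i => (γ ^ i) x) e
    rw [Finset.prod_range_succ, hx, pow_zero, AlgEquiv.one_apply] at h1
    rw [map_prod, mul_right_cancel₀ hx0 h1]
    exact Finset.prod_congr rfl fun i _ => by rw [pow_succ', AlgEquiv.mul_apply]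
  obtain ⟨y, hy⟩ := hfix _ hfixed
  have hv : v (algebraMap K L y) = v x ^ e := by
    rw [hy, map_prod, Finset.prod_congr rfl fun i _ => h.invariant (γ ^ i) x]
    simp
  have he : 0 < e := Nat.pos_of_ne_zero (by rintro rfl; have := h.pos_degree; omega)
  have hy0 : y ≠ 0 := by
    rintro rfl
    rw [map_zero, map_zero] at hv
    exact hx0 (v.eq_zero.mp (pow_eq_zero_iff he.ne' |>.mp hv.symm))
  obtain ⟨b, hb⟩ := h.base y hy0
  rw [hb, ha, ← zpow_natCast, ← zpow_mul] at hv
  have := zpow_right_injective₀ h.pos h.lt_one.ne hv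
  refine ⟨b, ?_⟩
  rw [ha]
  congr 1
  have he' : (e : ℤ) ≠ 0 := by exact_mod_cast he.ne'
  apply mul_right_cancel₀ he'
  rw [← this, hn]
  push_cast
  ring

/-- The different of `L` over the fixed field of `γ ^ e` divides `d π ^ (d - 1)`. -/
theorem le_prod_sub (h : IsTotRamGenerator K v π r n) {γ : L ≃ₐ[K] L}
    (hfix : ∀ x, γ x = x → x ∈ Set.range (algebraMap K L)) {e d : ℕ} (hn : n = e * d)
    (hγ : γ ^ n = 1) :
    v d * r ^ (d - 1) ≤ ∏ j ∈ Finset.Ico 1 d, v ((γ ^ (e * j)) π - π) := by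
  have hd : 0 < d := Nat.pos_of_ne_zero (by rintro rfl; have := h.pos_degree; omega)
  set σ := γ ^ e with hσ
  have hσd : σ ^ d = 1 := by rw [hσ, ← pow_mul, ← hn, hγ]
  set P : L[X] := ∏ j ∈ Finset.range d, (X - C ((σ ^ j) π)) with hP
  have hPmap : P.map (σ : L →+* L) = P := by
    have h0 := Finset.prod_range_succ' (fun j => X - C ((σ ^ j) π)) d
    rw [Finset.prod_range_succ, hσd, pow_zero] at h0
    have h1 := mul_right_cancel₀ (X_sub_C_ne_zero _) h0
    rw [hP, Polynomial.map_prod]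
    conv_rhs => rw [h1]
    refine Finset.prod_congr rfl fun j _ => ?_
    rw [pow_succ', AlgEquiv.mul_apply]
    simp
  have hmonic : P.Monic := monic_prod_of_monic _ _ fun j _ => monic_X_sub_C _
  have hdeg : P.natDegree = d := by
    rw [hP, natDegree_prod_of_monic _ _ fun j _ => monic_X_sub_C _]
    simp
  have hcoeff : ∀ i, σ (P.derivative.coeff i) = P.derivative.coeff i := by
    intro i
    have : (P.derivative.map (σ : L →+* L)) = P.derivative := by
      rw [← derivative_map, hPmap]
    conv_rhs => rw [← this, coeff_map]
    rfl
  have heval : P.derivative.eval π = ∏ j ∈ Finset.Ico 1 d, (π - (σ ^ j) π) := by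
    rw [hP, Finset.range_eq_Ico, Finset.prod_eq_prod_Ico_succ_bot hd, derivative_mul, pow_zero]
    simp [eval_prod]
  have hsum : P.derivative.eval π = ∑ i ∈ Finset.range d, P.derivative.coeff i * π ^ i := by
    rw [eval_eq_sum_range' (n := d)]
    have := natDegree_derivative_lt (p := P) (by omega)
    omega
  obtain ⟨j, -, hj, hmax⟩ := exists_apply_sum_mul_pow_eq h.nonarch h.pos h.lt_one h.map_gen hd
    (fun i => P.derivative.coeff i)
    (fun i _ hi => h.exists_zpow_of_fixed_pow hfix hn (hcoeff i) hi)
  rw [← hj, ← hsum, heval] at hmax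
  have htop := hmax (d - 1) (by omega)
  have hc : P.derivative.coeff (d - 1) = d := by
    have h1 : P.coeff d = 1 := by rw [← hdeg]; exact hmonic.coeff_natDegree
    rw [coeff_derivative, Nat.sub_add_cancel hd, h1, one_mul]
    exact_mod_cast congrArg (Nat.cast (R := L)) (Nat.sub_add_cancel hd)
  rw [hc, map_mul, map_pow, h.map_gen, map_prod] at htop
  refine htop.trans_eq (Finset.prod_congr rfl fun j _ => ?_)
  rw [v.map_sub, pow_mul]

/-- The ramification number `t` of `σ`: `v (σ π - π) = r ^ (t + 1)`. -/
theorem exists_ramification_number (h : IsTotRamGenerator K v π r n) {σ : L ≃ₐ[K] L}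
    (hσ : σ ≠ 1) : ∃ t : ℤ, 0 ≤ t ∧ v (σ π - π) = r ^ (t + 1) := by
  have hne : σ π - π ≠ 0 := fun h0 => hσ (h.eq_one_of_fixed (sub_eq_zero.mp h0))
  obtain ⟨b, hb⟩ := h.exists_zpow hne
  refine ⟨b - 1, ?_, by rw [hb]; congr 1; ring⟩
  have hle : v (σ π - π) ≤ r ^ (1 : ℤ) := by
    rw [zpow_one, sub_eq_add_neg]
    refine (h.nonarch _ _).trans (max_le ?_ ?_)
    · rw [h.invariant, h.map_gen]
    · rw [v.map_neg, h.map_gen]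
  rw [hb, zpow_le_zpow_iff_right_of_lt_one₀ h.pos h.lt_one] at hle
  omega

/-- The ramification numbers of the powers of a generator of a cyclic extension of degree `p ^ m`
of an unramified base. -/
theorem exists_ramification_numbers {p m : ℕ} [Fact p.Prime] (hp3 : 3 ≤ p)
    (h : IsTotRamGenerator K v π r (p ^ m)) (hvp : v p = r ^ (p ^ m)) {γ : L ≃ₐ[K] L}
    (hfix : ∀ x, γ x = x → x ∈ Set.range (algebraMap K L)) (hγ : orderOf γ = p ^ m) :
    ∃ t : ℕ → ℤ, ∀ j ∈ Finset.Ico 1 (p ^ m), v ((γ ^ j) π - π) = r ^ (t j + 1) ∧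
      (p - 1) * t j ≤ p * p ^ padicValNat p j - 1 := by
  have hp : p.Prime := Fact.out
  have hne : ∀ j, ¬p ^ m ∣ j → γ ^ j ≠ 1 := fun j hj h1 =>
    hj (hγ ▸ orderOf_dvd_of_pow_eq_one h1)
  have hex : ∀ j, ∃ t : ℤ, ¬p ^ m ∣ j → 0 ≤ t ∧ v ((γ ^ j) π - π) = r ^ (t + 1) := by
    intro j
    by_cases hj : p ^ m ∣ j
    · exact ⟨0, fun h' => absurd hj h'⟩
    · obtain ⟨t, ht⟩ := h.exists_ramification_number (hne j hj)
      exact ⟨t, fun _ => ht⟩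
  choose t ht using hex
  have hmono : ∀ i j, ¬p ^ m ∣ i → ¬p ^ m ∣ j → (∃ k, γ ^ j = (γ ^ i) ^ k) → t i ≤ t j := by
    rintro i j hi hj ⟨k, hk⟩
    have hle := h.apply_pow_sub_le (γ ^ i) k
    rw [← hk, (ht i hi).2, (ht j hj).2, zpow_le_zpow_iff_right_of_lt_one₀ h.pos h.lt_one] at hle
    omega
  have hndvd : ∀ s < m, ∀ u, ¬p ∣ u → ¬p ^ m ∣ p ^ s * u := by
    intro s hs u hu hdvd
    have h1 : p ^ s * p ∣ p ^ s * u := by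
      rw [← pow_succ]
      exact (pow_dvd_pow p hs).trans hdvd
    exact hu (Nat.dvd_of_mul_dvd_mul_left (pow_pos hp.pos s) h1)
  have hndvd' : ∀ s < m, ¬p ^ m ∣ p ^ s := fun s hs => by
    simpa using hndvd s hs 1 hp.not_dvd_one
  have hmul : ∀ s < m, ∀ u, ¬p ∣ u → t (p ^ s) = t (p ^ s * u) := by
    intro s hs u hu
    refine le_antisymm (hmono _ _ (hndvd' s hs) (hndvd s hs u hu) ⟨u, pow_mul _ _ _⟩)
      (hmono _ _ (hndvd s hs u hu) (hndvd' s hs) ?_)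
    have hcop : (orderOf γ).Coprime u := by
      rw [hγ]
      exact Nat.Coprime.pow_left _ (hp.coprime_iff_not_dvd.mpr hu)
    obtain ⟨k, hk⟩ := exists_pow_eq_self_of_coprime (x := γ) hcop.symm
    refine ⟨k, ?_⟩
    rw [← pow_mul, mul_assoc, mul_comm, pow_mul, pow_mul, hk]
  have hvpow : ∀ k : ℕ, v ((p ^ k : ℕ) : L) = r ^ ((p ^ m * k : ℕ) : ℤ) := by
    intro k
    rw [Nat.cast_pow, map_pow, hvp, ← pow_mul, zpow_natCast]
  have hgen : ∀ k s, s + k + 1 = m → (p - 1) * t (p ^ s) ≤ p ^ (s + 1) - 1 := by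
    intro k
    induction k using Nat.strong_induction_on with
    | _ k ih =>
    intro s hs
    have hp1 : (1 : ℤ) < p := by exact_mod_cast hp.one_lt
    have hstep : ∀ s', s ≤ s' → s' + 1 < m → p * t (p ^ s') ≤ t (p ^ (s' + 1)) := by
      intro s' hss' hs'm
      obtain ⟨h0, ht0⟩ := ht _ (hndvd' s' (by omega))
      obtain ⟨h1, ht1⟩ := ht _ (hndvd' (s' + 1) hs'm)
      have hle := h.apply_pow_prime_sub_le (s := r ^ t (p ^ s')) hp (zpow_nonneg h.pos.le _)
        (by simpa using (zpow_le_zpow_iff_right_of_lt_one₀ h.pos h.lt_one).mpr h0)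
        (by rw [ht0, zpow_add_one₀ h.pos.ne'])
      rw [← pow_mul, ← pow_succ, ht1, zpow_add_one₀ h.pos.ne',
        mul_le_mul_iff_left₀ h.pos, hvp, le_max_iff] at hle
      rcases hle with hle | hle
      · rw [← zpow_natCast, ← zpow_add₀ h.pos.ne',
          zpow_le_zpow_iff_right_of_lt_one₀ h.pos h.lt_one] at hle
        have hih := ih (k - (s' + 1 - s)) (by omega) (s' + 1) (by omega)
        have hpow : (p : ℤ) ^ (s' + 1 + 1) ≤ p ^ m := pow_le_pow_right₀ hp1.le (by omega)
        push_cast at hle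
        nlinarith
      · rw [← zpow_natCast, ← zpow_mul,
          zpow_le_zpow_iff_right_of_lt_one₀ h.pos h.lt_one] at hle
        linarith
    have hchain : ∀ a, s + a < m → p ^ a * t (p ^ s) ≤ t (p ^ (s + a)) := by
      intro a
      induction a with
      | zero => intro _; simp
      | succ a iha =>
        intro ha
        refine le_trans ?_ (hstep (s + a) (by omega) ha)
        rw [pow_succ', mul_assoc]
        exact mul_le_mul_of_nonneg_left (iha (by omega)) (by omega)
    have hlow : ∀ j ∈ Finset.Ico 1 (p ^ (k + 1)),
        ¬p ^ m ∣ p ^ s * j ∧ p ^ padicValNat p j * t (p ^ s) ≤ t (p ^ s * j) := by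
      intro j hj
      rw [Finset.mem_Ico] at hj
      obtain ⟨a, u, hu, rfl⟩ := Nat.exists_eq_pow_mul_and_not_dvd (n := j) (by omega) p hp.ne_one
      have hu0 : 0 < u := Nat.pos_of_ne_zero (by rintro rfl; simp at hu)
      have hak : a < k + 1 := by
        rw [← Nat.pow_lt_pow_iff_right hp.one_lt]
        exact lt_of_le_of_lt (Nat.le_mul_of_pos_right _ hu0) hj.2
      have hval : padicValNat p (p ^ a * u) = a := by
        rw [padicValNat.mul (pow_ne_zero _ hp.ne_zero) hu0.ne', padicValNat.prime_pow,
          padicValNat.eq_zero_of_not_dvd hu, add_zero]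
      rw [hval, ← mul_assoc, ← pow_add, ← hmul (s + a) (by omega) u hu]
      exact ⟨hndvd _ (by omega) u hu, hchain a (by omega)⟩
    have hprod := h.le_prod_sub hfix (e := p ^ s) (d := p ^ (k + 1))
      (by rw [← pow_add]; congr 1; omega) (hγ ▸ pow_orderOf_eq_one γ)
    rw [Finset.prod_congr rfl fun j hj => (ht _ (hlow j hj).1).2,
      prod_zpow_eq_zpow_sum h.pos.ne', hvpow, ← zpow_natCast, ← zpow_add₀ h.pos.ne',
      zpow_le_zpow_iff_right_of_lt_one₀ h.pos h.lt_one] at hprod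
    have hsumlow := Finset.sum_le_sum fun j hj => (hlow j hj).2
    have hid := sum_mul_pow_padicValNat p (k + 1)
    rw [← Finset.mul_sum] at hid
    rw [← Finset.sum_mul] at hsumlow
    rw [Finset.sum_add_distrib, Finset.sum_const, Nat.card_Ico, nsmul_one,
      Nat.cast_sub (Nat.one_le_pow _ _ hp.pos)] at hprod
    set S := ∑ j ∈ Finset.Ico 1 (p ^ (k + 1)), (p : ℤ) ^ padicValNat p j
    have hm : (p : ℤ) ^ m = p ^ s * p ^ (k + 1) := by rw [← pow_add]; congr 1; omega
    push_cast [Nat.cast_sub (Nat.one_le_pow _ _ hp.pos)] at hprod hid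
    have hle : S * t (p ^ s) ≤ p ^ s * p ^ (k + 1) * (k + 1) := by
      rw [← hm]; linarith
    have hcancel : ((k + 1) * p ^ (k + 1) : ℤ) * ((p - 1) * t (p ^ s)) ≤
        ((k + 1) * p ^ (k + 1) : ℤ) * p ^ (s + 1) := by
      calc ((k + 1) * p ^ (k + 1) : ℤ) * ((p - 1) * t (p ^ s))
          = p * (S * t (p ^ s)) := by linear_combination (-t (p ^ s)) * hid
        _ ≤ p * (p ^ s * p ^ (k + 1) * (k + 1)) := mul_le_mul_of_nonneg_left hle (by omega)
        _ = _ := by ring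
    have hmain := le_of_mul_le_mul_left hcancel (by positivity)
    refine Int.le_sub_one_of_lt (lt_of_le_of_ne hmain fun heq => ?_)
    have hdvd : (p - 1 : ℤ) ∣ 1 := by
      have h1 : (p - 1 : ℤ) ∣ p ^ (s + 1) - 1 := sub_one_dvd_pow_sub_one _ _
      have h2 := dvd_sub (Dvd.intro _ heq) h1
      simpa using h2
    have := Int.le_of_dvd one_pos hdvd
    omega
  refine ⟨t, fun j hj => ?_⟩
  rw [Finset.mem_Ico] at hj
  obtain ⟨a, u, hu, rfl⟩ := Nat.exists_eq_pow_mul_and_not_dvd (n := j) (by omega) p hp.ne_one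
  have hu0 : 0 < u := Nat.pos_of_ne_zero (by rintro rfl; simp at hu)
  have ham : a < m := by
    rw [← Nat.pow_lt_pow_iff_right hp.one_lt]
    exact lt_of_le_of_lt (Nat.le_mul_of_pos_right _ hu0) hj.2
  have hval : padicValNat p (p ^ a * u) = a := by
    rw [padicValNat.mul (pow_ne_zero _ hp.ne_zero) hu0.ne', padicValNat.prime_pow,
      padicValNat.eq_zero_of_not_dvd hu, add_zero]
  refine ⟨(ht _ (hndvd a ham u hu)).2, ?_⟩
  rw [hval, ← hmul a ham u hu, ← pow_succ']
  exact hgen (m - a - 1) a (by omega)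

/-- The product of all `v (σ π - π)` with one factor repeated, for `σ` running over the nontrivial
elements of a cyclic Galois group of order `p ^ m`. -/
theorem le_prod_mul {p m : ℕ} [Fact p.Prime] (hp3 : 3 ≤ p)
    (h : IsTotRamGenerator K v π r (p ^ m)) (hvp : v p = r ^ (p ^ m)) {γ : L ≃ₐ[K] L}
    (hfix : ∀ x, γ x = x → x ∈ Set.range (algebraMap K L)) (hγ : orderOf γ = p ^ m)
    {i : ℕ} (hi : i ∈ Finset.Ico 1 (p ^ m)) :
    r ^ ((m + 1) * p ^ m) ≤
      v ((γ ^ i) π - π) * ∏ j ∈ Finset.Ico 1 (p ^ m), v ((γ ^ j) π - π) := by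
  have hp : p.Prime := Fact.out
  obtain ⟨t, ht⟩ := h.exists_ramification_numbers hp3 hvp hfix hγ
  rw [(ht i hi).1, Finset.prod_congr rfl fun j hj => (ht j hj).1,
    prod_zpow_eq_zpow_sum h.pos.ne', ← zpow_natCast, ← zpow_add₀ h.pos.ne',
    zpow_le_zpow_iff_right_of_lt_one₀ h.pos h.lt_one]
  have hsum := Finset.sum_le_sum fun j hj => (ht j hj).2
  rw [Finset.sum_sub_distrib, sum_mul_pow_padicValNat, ← Finset.mul_sum, Finset.sum_const,
    Nat.card_Ico, nsmul_one] at hsum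
  rw [Finset.sum_add_distrib, Finset.sum_const, Nat.card_Ico, nsmul_one]
  have hti : (p - 1) * t i ≤ p ^ m - 1 := by
    refine (ht i hi).2.trans ?_
    have hi' := Finset.mem_Ico.mp hi
    have hlt : padicValNat p i + 1 ≤ m := by
      rw [Nat.succ_le_iff, ← Nat.pow_lt_pow_iff_right hp.one_lt]
      exact lt_of_le_of_lt (Nat.le_of_dvd hi'.1 pow_padicValNat_dvd) hi'.2
    rw [← pow_succ']
    have : (p : ℤ) ^ (padicValNat p i + 1) ≤ p ^ m :=
      pow_le_pow_right₀ (by exact_mod_cast hp.one_lt.le) hlt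
    linarith
  push_cast [Nat.cast_sub (Nat.one_le_pow _ _ hp.pos)] at hsum ⊢
  have hp1 : (0 : ℤ) < p - 1 := by omega
  have : t i + ∑ j ∈ Finset.Ico 1 (p ^ m), t j ≤ m * p ^ m := by
    refine le_of_mul_le_mul_left ?_ hp1
    linarith
  linarith

end IsTotRamGenerator

theorem isIntegral_iff_norm_coeff_minpoly_le_one (p : ℕ) [Fact p.Prime] (K : Type) [Field K]
    [Algebra ℚ_[p] K] [FiniteDimensional ℚ_[p] K] (x : K) :
    IsIntegral ℤ_[p] x ↔ ∀ i, ‖(minpoly ℚ_[p] x).coeff i‖ ≤ 1 := by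
  have : IsScalarTower ℤ_[p] ℚ_[p] K := IsScalarTower.of_algebraMap_eq' rfl
  constructor
  · intro hx i
    rw [minpoly.isIntegrallyClosed_eq_field_fractions' ℚ_[p] hx, coeff_map]
    exact PadicInt.norm_le_one _
  · intro h
    have hlift : minpoly ℚ_[p] x ∈ lifts (algebraMap ℤ_[p] ℚ_[p]) :=
      (lifts_iff_coeff_lifts _).mpr fun i => ⟨⟨_, h i⟩, rfl⟩
    obtain ⟨q, hq, -, hqm⟩ := lifts_and_natDegree_eq_and_monic hlift
      (minpoly.monic (Algebra.IsIntegral.isIntegral x))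
    refine ⟨q, hqm, ?_⟩
    rw [IsScalarTower.algebraMap_eq ℤ_[p] ℚ_[p] K, ← eval₂_map, hq]
    exact minpoly.aeval ℚ_[p] x

/-- The `p`-adic absolute value of an algebraic closure of `K`. -/
theorem exists_absoluteValue (p : ℕ) [Fact p.Prime] (K : Type) [Field K] [Algebra ℚ_[p] K]
    [FiniteDimensional ℚ_[p] K] (Ω : Type) [Field Ω] [Algebra K Ω] [Algebra.IsAlgebraic K Ω] :
    ∃ v : AbsoluteValue Ω ℝ, IsNonarchimedean v ∧ (∀ (σ : Ω ≃ₐ[K] Ω) x, v (σ x) = v x) ∧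
      v (p : Ω) = (p : ℝ)⁻¹ ∧ ∀ x : K, IsIntegral ℤ_[p] x ↔ v (algebraMap K Ω x) ≤ 1 := by
  let _ : Algebra ℚ_[p] Ω := ((algebraMap K Ω).comp (algebraMap ℚ_[p] K)).toAlgebra
  have : IsScalarTower ℚ_[p] K Ω := IsScalarTower.of_algebraMap_eq' rfl
  have : Algebra.IsAlgebraic ℚ_[p] Ω := Algebra.IsAlgebraic.trans ℚ_[p] K Ω
  refine ⟨⟨⟨spectralNorm ℚ_[p] Ω, fun x y => ?_⟩, fun x => spectralNorm_nonneg x, fun x => ?_,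
    fun x y => ?_⟩, isNonarchimedean_spectralNorm, fun σ x => ?_, ?_, fun x => ?_⟩
  · exact map_mul (spectralMulAlgNorm ℚ_[p] Ω) x y
  · exact ⟨fun h => eq_zero_of_map_spectralNorm_eq_zero h (Algebra.IsAlgebraic.isAlgebraic x),
      fun h => by rw [h]; exact spectralNorm_zero⟩
  · exact map_add_le_add (spectralMulAlgNorm ℚ_[p] Ω) x y
  · exact (spectralNorm_eq_of_equiv (σ.restrictScalars ℚ_[p]) x).symm
  · have := spectralNorm_extends (L := Ω) (p : ℚ_[p])
    rw [map_natCast, Padic.norm_p] at this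
    exact this
  · have h1 : spectralNorm ℚ_[p] Ω (algebraMap K Ω x) = spectralNorm ℚ_[p] K x :=
      (spectralNorm.eq_of_tower x).symm
    change _ ↔ spectralNorm ℚ_[p] Ω (algebraMap K Ω x) ≤ 1
    rw [h1, spectralNorm, spectralValue_le_one_iff (minpoly.monic (Algebra.IsIntegral.isIntegral x)),
      isIntegral_iff_norm_coeff_minpoly_le_one]

/-- The nonzero elements of `K` have absolute values in `v p ^ ℤ`. -/
theorem exists_apply_eq_zpow (p : ℕ) [Fact p.Prime] (K : Type) [Field K] [Algebra ℚ_[p] K]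
    [FiniteDimensional ℚ_[p] K]
    (hKloc : ∀ x : integralClosure ℤ_[p] K, ¬IsUnit x → (p : integralClosure ℤ_[p] K) ∣ x)
    (v : AbsoluteValue K ℝ) (hvp : v (p : K) < 1)
    (hint : ∀ x : K, IsIntegral ℤ_[p] x ↔ v x ≤ 1) {x : K} (hx : x ≠ 0) :
    ∃ b : ℤ, v x = v (p : K) ^ b := by
  have : CharZero K := charZero_of_injective_algebraMap (algebraMap ℚ_[p] K).injective
  have hp0 : (p : K) ≠ 0 := Nat.cast_ne_zero.mpr (Fact.out : p.Prime).ne_zero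
  have hdvd : ∀ x : K, x ≠ 0 → v x ≤ 1 → v x ≠ 1 → v (x / p) ≤ 1 := by
    intro x hx hx1 hne
    have hnu : ¬IsUnit (⟨x, (hint x).mpr hx1⟩ : integralClosure ℤ_[p] K) := by
      intro hu
      obtain ⟨y, hy⟩ := hu.exists_right_inv
      have hy1 : v (y : K) ≤ 1 := (hint _).mp y.2
      have hxy : x * (y : K) = 1 := congrArg Subtype.val hy
      have := congrArg v hxy
      rw [map_mul, map_one] at this
      have := mul_le_mul_of_nonneg_left hy1 (v.nonneg x)
      exact hne (le_antisymm hx1 (by linarith))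
    obtain ⟨y, hy⟩ := hKloc _ hnu
    have hxy : x = p * (y : K) := congrArg Subtype.val hy
    rw [hxy, mul_div_cancel_left₀ _ hp0]
    exact (hint _).mp y.2
  have hvp0 : 0 < v (p : K) := v.pos hp0
  have hle : ∀ x : K, x ≠ 0 → v x ≤ 1 → ∃ b : ℤ, v x = v (p : K) ^ b := by
    intro x hx hx1
    by_contra! hcon
    have hall : ∀ k : ℕ, v (x / p ^ k) ≤ 1 := by
      intro k
      induction k with
      | zero => simpa using hx1
      | succ k ih =>
        rw [pow_succ, ← div_div]
        refine hdvd _ (div_ne_zero hx (pow_ne_zero _ hp0)) ih fun h1 => hcon k ?_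
        rw [map_div₀, map_pow, div_eq_one_iff_eq (pow_ne_zero _ hvp0.ne')] at h1
        rw [h1, zpow_natCast]
    obtain ⟨k, hk⟩ := exists_pow_lt_of_lt_one (v.pos hx) hvp
    have := hall k
    rw [map_div₀, map_pow, div_le_one (pow_pos hvp0 _)] at this
    linarith
  rcases le_total (v x) 1 with h | h
  · exact hle x hx h
  · obtain ⟨b, hb⟩ := hle x⁻¹ (inv_ne_zero hx) (by rw [map_inv₀]; exact inv_le_one_of_one_le₀ h)
    exact ⟨-b, by rw [zpow_neg, ← hb, map_inv₀, inv_inv]⟩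

/-- The monic polynomial `X ^ n + f 1 X ^ (n - 1) + ⋯ + f n`. -/
noncomputable def monicOfCoeffs {R : Type*} [CommRing R] (n : ℕ) (f : ℕ → R) : R[X] :=
  X ^ n + ∑ i ∈ Finset.range n, C (f (i + 1)) * X ^ (n - (i + 1))

section MonicOfCoeffs

variable {R : Type*} [CommRing R] (n : ℕ) (f : ℕ → R)

theorem degree_sum_coeffs_lt :
    (∑ i ∈ Finset.range n, C (f (i + 1)) * X ^ (n - (i + 1)) : R[X]).degree < n := by
  rw [degree_lt_iff_coeff_zero]
  intro k hk
  rw [finsetSum_coeff]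
  refine Finset.sum_eq_zero fun i hi => ?_
  rw [Finset.mem_range] at hi
  rw [coeff_C_mul, coeff_X_pow, if_neg (by omega), mul_zero]

theorem monicOfCoeffs_monic : (monicOfCoeffs n f).Monic :=
  monic_X_pow_add (degree_sum_coeffs_lt n f)

theorem natDegree_monicOfCoeffs [Nontrivial R] : (monicOfCoeffs n f).natDegree = n := by
  refine natDegree_eq_of_degree_eq_some ?_
  rw [monicOfCoeffs, degree_add_eq_left_of_degree_lt, degree_X_pow]
  rw [degree_X_pow]
  exact degree_sum_coeffs_lt n f

theorem aeval_monicOfCoeffs {A : Type*} [CommRing A] [Algebra R A] (x : A) :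
    aeval x (monicOfCoeffs n f) =
      x ^ n + ∑ i ∈ Finset.range n, algebraMap R A (f (i + 1)) * x ^ (n - (i + 1)) := by
  simp [monicOfCoeffs]

end MonicOfCoeffs

section

variable {K Ω : Type*} [Field K] [Field Ω] [Algebra K Ω] {v : AbsoluteValue Ω ℝ}

/-- The absolute value of a root of an Eisenstein polynomial. -/
theorem apply_root_pow_eq (hv : IsNonarchimedean v) {n : ℕ} (hn : 0 < n) {f : ℕ → K} {ρ : ℝ}
    (hρ : 0 < ρ) (hρ1 : ρ < 1) (hf : ∀ i, 1 ≤ i → i ≤ n → v (algebraMap K Ω (f i)) ≤ ρ)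
    (hfn : v (algebraMap K Ω (f n)) = ρ) {x : Ω} (hx : aeval x (monicOfCoeffs n f) = 0) :
    v x ^ n = ρ := by
  rw [aeval_monicOfCoeffs, add_eq_zero_iff_eq_neg] at hx
  have hx' := congrArg v hx
  rw [v.map_neg, map_pow] at hx'
  have hx1 : v x < 1 := by
    by_contra! hge
    obtain ⟨i, hi, hle⟩ := hv.finset_image_add_of_nonempty
      (fun i => algebraMap K Ω (f (i + 1)) * x ^ (n - (i + 1)))
      (Finset.nonempty_range_iff.mpr hn.ne')
    rw [← hx', map_mul, map_pow] at hle
    have hi' := Finset.mem_range.mp hi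
    have hlt : v (algebraMap K Ω (f (i + 1))) * v x ^ (n - (i + 1)) < v x ^ n :=
      calc v (algebraMap K Ω (f (i + 1))) * v x ^ (n - (i + 1))
          ≤ ρ * v x ^ n := mul_le_mul (hf _ (by omega) (by omega))
            (pow_le_pow_right₀ hge (by omega)) (pow_nonneg (v.nonneg _) _) hρ.le
        _ < 1 * v x ^ n := mul_lt_mul_of_pos_right hρ1 (by positivity)
        _ = v x ^ n := one_mul _
    linarith
  rw [hx', hv.apply_sum_eq_of_lt (k := n - 1) (fun x => (v.map_neg x).symm)
    (Finset.mem_range.mpr (by omega)), Nat.sub_add_cancel hn, hfn.symm]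
  · simp
  · intro i hi hne
    rw [Finset.mem_range] at hi
    rw [Nat.sub_add_cancel hn, Nat.sub_self, pow_zero, mul_one, hfn, map_mul, map_pow]
    calc v (algebraMap K Ω (f (i + 1))) * v x ^ (n - (i + 1))
        ≤ ρ * v x ^ (n - (i + 1)) :=
          mul_le_mul_of_nonneg_right (hf _ (by omega) (by omega)) (pow_nonneg (v.nonneg _) _)
      _ < ρ * 1 :=
          mul_lt_mul_of_pos_left (pow_lt_one₀ (v.nonneg _) hx1 (by omega)) hρ
      _ = ρ := mul_one ρ

/-- The congruence of the coefficients bounds `f` at the roots of `g`. -/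
theorem apply_aeval_le (hv : IsNonarchimedean v) {n c : ℕ} (hn : 0 < n) {f g : ℕ → K} {r : ℝ}
    (hr : 0 < r) (hr1 : r < 1) {x : Ω} (hx : v x = r)
    (hcong : ∀ i, 1 ≤ i → i ≤ n - 1 → v (algebraMap K Ω (f i - g i)) ≤ r ^ (n * c))
    (hcongn : v (algebraMap K Ω (f n - g n)) ≤ r ^ (n * (c + 1)))
    (hg : aeval x (monicOfCoeffs n g) = 0) :
    v (aeval x (monicOfCoeffs n f)) ≤ r ^ (c * n + 1) := by
  have hsub : aeval x (monicOfCoeffs n f) =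
      ∑ i ∈ Finset.range n, algebraMap K Ω (f (i + 1) - g (i + 1)) * x ^ (n - (i + 1)) := by
    rw [← sub_zero (aeval x (monicOfCoeffs n f)), ← hg, aeval_monicOfCoeffs, aeval_monicOfCoeffs,
      add_sub_add_left_eq_sub, ← Finset.sum_sub_distrib]
    exact Finset.sum_congr rfl fun i _ => by rw [map_sub, sub_mul]
  obtain ⟨i, hi, hle⟩ := hv.finset_image_add_of_nonempty
    (fun i => algebraMap K Ω (f (i + 1) - g (i + 1)) * x ^ (n - (i + 1)))
    (Finset.nonempty_range_iff.mpr hn.ne')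
  have hi' := Finset.mem_range.mp hi
  rw [hsub]
  refine hle.trans ?_
  rw [map_mul, map_pow, hx]
  rcases Nat.lt_or_ge (i + 1) n with hlt | hge
  · refine (mul_le_mul_of_nonneg_right (hcong _ (by omega) (by omega))
      (pow_nonneg hr.le _)).trans ?_
    rw [← pow_add, mul_comm n c]
    exact pow_le_pow_of_le_one hr.le hr1.le (by omega)
  · obtain rfl : i + 1 = n := by omega
    rw [Nat.sub_self, pow_zero, mul_one]
    refine hcongn.trans (pow_le_pow_of_le_one hr.le hr1.le ?_)
    nlinarith

theorem isTotRamGenerator_adjoin [Normal K Ω] {π : Ω} {n : ℕ} (hn : 0 < n)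
    (hv : IsNonarchimedean v) (hinv : ∀ (σ : Ω ≃ₐ[K] Ω) x, v (σ x) = v x)
    (hπ : IsIntegral K π) (hdeg : Module.finrank K K⟮π⟯ = n) (hr : 0 < v π) (hr1 : v π < 1)
    (hbase : ∀ a : K, a ≠ 0 → ∃ b : ℤ, v (algebraMap K Ω a) = v π ^ ((n : ℤ) * b)) :
    IsTotRamGenerator K (v.comp (algebraMap K⟮π⟯ Ω).injective) (AdjoinSimple.gen K π) (v π) n where
  nonarch x y := hv (algebraMap K⟮π⟯ Ω x) (algebraMap K⟮π⟯ Ω y)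
  pos := hr
  lt_one := hr1
  map_gen := rfl
  pos_degree := hn
  base a ha := hbase a ha
  expand x := by
    obtain ⟨q, hq, hx⟩ := (adjoin.powerBasis hπ).exists_eq_aeval x
    rw [← (adjoin.powerBasis hπ).finrank, hdeg] at hq
    refine ⟨q.coeff, ?_⟩
    rw [hx, adjoin.powerBasis_gen, aeval_eq_sum_range' hq]
    simp only [Algebra.smul_def]
  invariant σ x := by
    have h1 := hinv (σ.liftNormal Ω) (algebraMap K⟮π⟯ Ω x)
    rw [σ.liftNormal_commutes Ω] at h1
    exact h1

/-- **Krasner's lemma** for an element all of whose conjugates are the `γ ^ j π`. -/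
theorem mem_adjoin_of_apply_sub_lt [IsGalois K Ω] (hv : IsNonarchimedean v)
    (hinv : ∀ (σ : Ω ≃ₐ[K] Ω) x, v (σ x) = v x) {π δ : Ω}
    (hlt : ∀ τ : Ω ≃ₐ[K] Ω, τ π ≠ π → v (δ - π) < v (τ π - π)) : π ∈ K⟮δ⟯ := by
  have hmem : π ∈ Set.range (algebraMap K⟮δ⟯ Ω) := by
    rw [InfiniteGalois.mem_range_algebraMap_iff_fixed]
    intro τ
    by_contra hne
    have h1 := hlt (τ.restrictScalars K) hne
    have hδ : τ.restrictScalars K δ = δ := τ.commutes (AdjoinSimple.gen K δ)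
    have h2 : τ.restrictScalars K π - π = τ.restrictScalars K (π - δ) + (δ - π) := by
      rw [map_sub, hδ]; ring
    have h3 := hv (τ.restrictScalars K (π - δ)) (δ - π)
    rw [← h2, hinv, v.map_sub π δ, max_self] at h3
    linarith
  obtain ⟨y, rfl⟩ := hmem
  exact y.2

/-- Over a base of absolute ramification index one, an Eisenstein polynomial of degree `p ^ m`
congruent to one with a cyclic root field has a root generating the same field. -/
theorem exists_root_adjoin_eq [CharZero K] [IsAlgClosure K Ω] (hv : IsNonarchimedean v)
    (hinv : ∀ (σ : Ω ≃ₐ[K] Ω) x, v (σ x) = v x) {p : ℕ} [Fact p.Prime] (hp3 : 3 ≤ p)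
    (hvp : v (p : Ω) < 1) (hbase : ∀ a : K, a ≠ 0 → ∃ b : ℤ, v (algebraMap K Ω a) = v (p : Ω) ^ b)
    {n m : ℕ} (hn : n = p ^ m) {f g : ℕ → K}
    (hf : ∀ i, 1 ≤ i → i ≤ n → v (algebraMap K Ω (f i)) ≤ v (p : Ω))
    (hfn : v (algebraMap K Ω (f n)) = v (p : Ω))
    (hg : ∀ i, 1 ≤ i → i ≤ n → v (algebraMap K Ω (g i)) ≤ v (p : Ω))
    (hgn : v (algebraMap K Ω (g n)) = v (p : Ω))
    (hcong : ∀ i, 1 ≤ i → i ≤ n - 1 → v (algebraMap K Ω (f i - g i)) ≤ v (p : Ω) ^ (m + 1))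
    (hcongn : v (algebraMap K Ω (f n - g n)) ≤ v (p : Ω) ^ (m + 2))
    {π : Ω} (hπ : aeval π (monicOfCoeffs n f) = 0) [IsGalois K K⟮π⟯]
    [IsCyclic (K⟮π⟯ ≃ₐ[K] K⟮π⟯)] (hdeg : Module.finrank K K⟮π⟯ = n) :
    ∃ δ : Ω, aeval δ (monicOfCoeffs n g) = 0 ∧ K⟮δ⟯ = K⟮π⟯ := by
  have hp : p.Prime := Fact.out
  have hn0 : 0 < n := hn ▸ pow_pos hp.pos m
  have : Algebra.IsAlgebraic K Ω := IsAlgClosure.isAlgebraic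
  have : IsAlgClosed Ω := IsAlgClosure.isAlgClosed K
  have : IsGalois K Ω := {}
  have : CharZero Ω := charZero_of_injective_algebraMap (algebraMap K Ω).injective
  have hp0 : 0 < v (p : Ω) := v.pos (Nat.cast_ne_zero.mpr hp.ne_zero)
  have hvroot : v π ^ n = v (p : Ω) := apply_root_pow_eq hv hn0 hp0 hvp hf hfn hπ
  set r := v π with hr_def
  have hr0 : 0 < r := (v.nonneg π).lt_of_ne' fun h0 => by
    rw [hr_def, h0, zero_pow hn0.ne'] at hvroot; exact hp0.ne hvroot
  have hr1 : r < 1 := by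
    rw [← hvroot] at hvp
    exact (pow_lt_one_iff_of_nonneg hr0.le hn0.ne').mp hvp
  have hint : ∀ x : Ω, IsIntegral K x := fun x => Algebra.IsIntegral.isIntegral x
  have : FiniteDimensional K K⟮π⟯ := adjoin.finiteDimensional (hint π)
  have hram := isTotRamGenerator_adjoin hn0 hv hinv (hint π) hdeg hr0 hr1 fun a ha => by
    obtain ⟨b, hb⟩ := hbase a ha
    exact ⟨b, by rw [hb, ← hvroot, zpow_mul, zpow_natCast]⟩
  obtain ⟨γ, hγ⟩ := IsCyclic.exists_generator (α := K⟮π⟯ ≃ₐ[K] K⟮π⟯)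
  have hord : orderOf γ = n := by
    rw [orderOf_eq_card_of_forall_mem_zpowers hγ, IsGalois.card_aut_eq_finrank, hdeg]
  have hpowers : ∀ σ : K⟮π⟯ ≃ₐ[K] K⟮π⟯, ∃ j ∈ Finset.range n, γ ^ j = σ := by
    classical
    intro σ
    have := (mem_powers_iff_mem_range_orderOf (x := γ) (y := σ)).mp
      ((mem_powers_iff_mem_zpowers).mpr (hγ σ))
    rw [hord] at this
    simpa using this
  have hfix : ∀ x, γ x = x → x ∈ Set.range (algebraMap K K⟮π⟯) := by
    intro x hx
    rw [IsGalois.mem_range_algebraMap_iff_fixed]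
    intro σ
    obtain ⟨j, -, rfl⟩ := hpowers σ
    induction j with
    | zero => rfl
    | succ j ih => rw [pow_succ, AlgEquiv.mul_apply, hx, ih]
  set π' : K⟮π⟯ := AdjoinSimple.gen K π with hπ'
  set c : ℕ → Ω := fun j => algebraMap K⟮π⟯ Ω ((γ ^ j) π') with hc
  have hc0 : c 0 = π := rfl
  have hcinj : Set.InjOn c (Finset.range n : Set ℕ) := by
    intro i hi j hj hij
    have h1 : (γ ^ i) π' = (γ ^ j) π' := (algebraMap K⟮π⟯ Ω).injective hij
    have h2 : γ ^ i = γ ^ j := by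
      have := hram.eq_one_of_fixed (σ := (γ ^ j)⁻¹ * γ ^ i) (by
        rw [AlgEquiv.mul_apply, h1, ← AlgEquiv.mul_apply, inv_mul_cancel, AlgEquiv.one_apply])
      exact (inv_mul_eq_one.mp this).symm
    rw [← hord] at hi hj
    exact pow_injOn_Iio_orderOf (by simpa using hi) (by simpa using hj) h2
  have hcroot : ∀ j, aeval (c j) (monicOfCoeffs n f) = 0 := by
    intro j
    have h1 : aeval π' (monicOfCoeffs n f) = 0 := by
      apply (algebraMap K⟮π⟯ Ω).injective
      rw [← aeval_algebraMap_apply, map_zero]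
      exact hπ
    rw [hc, aeval_algebraMap_apply, aeval_algHom_apply, h1, map_zero, map_zero]
  have hprod : (monicOfCoeffs n f).map (algebraMap K Ω) =
      ∏ j ∈ Finset.range n, (X - C (c j)) := by
    have hm1 := (monicOfCoeffs_monic n f).map (algebraMap K Ω)
    have hm2 : (∏ j ∈ Finset.range n, (X - C (c j))).Monic :=
      monic_prod_of_monic _ _ fun j _ => monic_X_sub_C _
    refine (eq_of_monic_of_dvd_of_natDegree_le hm2 hm1 ?_ ?_)
    · refine Finset.prod_dvd_of_coprime ?_ ?_
      · intro i hi j hj hij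
        exact isCoprime_X_sub_C_of_isUnit_sub
          (sub_ne_zero.mpr fun h' => hij (hcinj hi hj h')).isUnit
      · intro j _
        rw [dvd_iff_isRoot, IsRoot, eval_map_algebraMap]
        exact hcroot j
    · rw [natDegree_map, natDegree_monicOfCoeffs,
        natDegree_prod_of_monic _ _ fun j _ => monic_X_sub_C _]
      simp
  have heval : ∀ x, aeval x (monicOfCoeffs n f) = ∏ j ∈ Finset.range n, (x - c j) := by
    intro x
    rw [← eval_map_algebraMap, hprod, eval_prod]
    simp
  obtain ⟨δ₀, hδ₀⟩ := IsAlgClosed.exists_aeval_eq_zero Ω (monicOfCoeffs n g) (by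
    rw [degree_eq_natDegree (monicOfCoeffs_monic n g).ne_zero, natDegree_monicOfCoeffs]
    exact_mod_cast hn0.ne')
  obtain ⟨k, hk, hkmin⟩ := Finset.exists_min_image (Finset.range n) (fun j => v (δ₀ - c j))
    ⟨0, Finset.mem_range.mpr hn0⟩
  set τ : Ω ≃ₐ[K] Ω := (γ ^ k).liftNormal Ω with hτ
  have hτc : ∀ j, τ (c j) = c (k + j) := by
    intro j
    rw [hc, hτ, (γ ^ k).liftNormal_commutes Ω, ← AlgEquiv.mul_apply, ← pow_add]
  set δ := τ.symm δ₀ with hδ_def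
  have hδ : aeval δ (monicOfCoeffs n g) = 0 := by
    rw [hδ_def, aeval_algHom_apply, hδ₀, map_zero]
  have hmin : ∀ j, v (δ - π) ≤ v (δ - c j) := by
    have htrans : ∀ j, v (δ - c j) = v (δ₀ - c (k + j)) := by
      intro j
      rw [← hinv τ, map_sub, hτc, hδ_def, AlgEquiv.apply_symm_apply]
    intro j
    obtain ⟨i, hi, hij⟩ := hpowers (γ ^ (k + j))
    rw [← hc0, htrans, htrans, add_zero]
    refine (hkmin i hi).trans_eq ?_
    rw [hc]
    simp only [hij]
  have hvδ : v δ = r := by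
    have := apply_root_pow_eq hv hn0 hp0 hvp hg hgn hδ
    exact (pow_left_inj₀ (v.nonneg _) hr0.le hn0.ne').mp (this.trans hvroot.symm)
  have hsmall := apply_aeval_le (c := m + 1) hv hn0 hr0 hr1 hvδ
    (fun i h1 h2 => (hcong i h1 h2).trans_eq (by rw [← hvroot, pow_mul]))
    (hcongn.trans_eq (by rw [← hvroot, pow_mul])) hδ
  have hclose : ∀ i ∈ Finset.Ico 1 n, v (δ - π) < v (c i - π) := by
    intro i hi
    by_contra! hle
    have hvp' : v.comp (algebraMap K⟮π⟯ Ω).injective (p : K⟮π⟯) = r ^ p ^ m := by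
      rw [← hn, hvroot]
      exact congrArg v (map_natCast (algebraMap K⟮π⟯ Ω) p)
    have hlow := (hn ▸ hram).le_prod_mul hp3 hvp' hfix (hn ▸ hord) (hn ▸ hi)
    have hcv : ∀ j, v.comp (algebraMap K⟮π⟯ Ω).injective ((γ ^ j) π' - π') = v (c j - π) :=
      fun j => congrArg v (map_sub (algebraMap K⟮π⟯ Ω) _ _)
    simp only [hcv, ← hn] at hlow
    have hup : v (c i - π) * ∏ j ∈ Finset.Ico 1 n, v (c j - π) ≤
        v (aeval δ (monicOfCoeffs n f)) := by
      rw [heval, map_prod, Finset.range_eq_Ico, Finset.prod_eq_prod_Ico_succ_bot hn0, hc0]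
      refine mul_le_mul hle (Finset.prod_le_prod (fun _ _ => v.nonneg _) fun j _ => ?_)
        (Finset.prod_nonneg fun _ _ => v.nonneg _) (v.nonneg _)
      rw [← sub_add_sub_cancel (c j) δ π]
      refine (hv _ _).trans (max_le (v.map_sub _ _).le (hmin j))
    have hlt : r ^ ((m + 1) * n + 1) < r ^ ((m + 1) * n) :=
      pow_lt_pow_right_of_lt_one₀ hr0 hr1 (Nat.lt_succ_self _)
    linarith
  have hmem : π ∈ K⟮δ⟯ := by
    refine mem_adjoin_of_apply_sub_lt hv hinv fun σ hσ => ?_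
    have hroot : ∏ j ∈ Finset.range n, (σ π - c j) = 0 := by
      rw [← heval, aeval_algHom_apply, hπ, map_zero]
    obtain ⟨j, hj, hj0⟩ := Finset.prod_eq_zero_iff.mp hroot
    rw [sub_eq_zero.mp hj0]
    refine hclose j (Finset.mem_Ico.mpr ⟨Nat.pos_of_ne_zero ?_, Finset.mem_range.mp hj⟩)
    rintro rfl
    exact hσ (sub_eq_zero.mp hj0)
  have : FiniteDimensional K K⟮δ⟯ := adjoin.finiteDimensional (hint δ)
  refine ⟨δ, hδ, (eq_of_le_of_finrank_le (adjoin_simple_le_iff.mpr hmem) ?_).symm⟩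
  rw [hdeg, adjoin.finrank (hint δ)]
  refine (natDegree_le_of_dvd (minpoly.dvd K δ hδ) (monicOfCoeffs_monic n g).ne_zero).trans_eq ?_
  exact natDegree_monicOfCoeffs n g

end

/-- An element of the ring of integers divisible by `p ^ k` has absolute value at most
`v p ^ k`. -/
theorem apply_le_pow_of_dvd {p : ℕ} [Fact p.Prime] {K : Type} [Field K] [Algebra ℚ_[p] K]
    {v : AbsoluteValue K ℝ} (hint : ∀ x : K, IsIntegral ℤ_[p] x ↔ v x ≤ 1) {k : ℕ}
    {x : integralClosure ℤ_[p] K} (hx : (p : integralClosure ℤ_[p] K) ^ k ∣ x) :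
    v (x : K) ≤ v (p : K) ^ k := by
  obtain ⟨u, rfl⟩ := hx
  push_cast
  rw [map_mul, map_pow]
  exact mul_le_of_le_one_right (pow_nonneg (v.nonneg _) _) ((hint _).mp u.2)

theorem apply_eq_of_dvd_of_not_sq_dvd {p : ℕ} [Fact p.Prime] {K : Type} [Field K]
    [Algebra ℚ_[p] K]
    (hKloc : ∀ x : integralClosure ℤ_[p] K, ¬IsUnit x → (p : integralClosure ℤ_[p] K) ∣ x)
    {v : AbsoluteValue K ℝ} (hint : ∀ x : K, IsIntegral ℤ_[p] x ↔ v x ≤ 1)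
    {x : integralClosure ℤ_[p] K} (hx : (p : integralClosure ℤ_[p] K) ∣ x)
    (hx' : ¬(p : integralClosure ℤ_[p] K) ^ 2 ∣ x) : v (x : K) = v (p : K) := by
  obtain ⟨u, rfl⟩ := hx
  have hu : IsUnit u := by
    by_contra hu
    exact hx' (by rw [sq]; exact mul_dvd_mul_left _ (hKloc u hu))
  obtain ⟨w, hw⟩ := hu.exists_right_inv
  have hw' : v (u : K) * v (w : K) = 1 := by
    rw [← map_mul, ← v.map_one]
    exact congrArg (fun y : integralClosure ℤ_[p] K => v (y : K)) hw
  have hu1 := (hint _).mp u.2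
  have hw1 := (hint _).mp w.2
  have hvu : v (u : K) = 1 := by nlinarith [v.nonneg (u : K), v.nonneg (w : K)]
  push_cast
  rw [map_mul, hvu, mul_one]

/-- The roots of a polynomial with one normal root field of maximal degree all generate that
field. -/
theorem adjoin_eq_of_aeval_eq_zero {K Ω : Type*} [Field K] [Field Ω] [Algebra K Ω] {q : K[X]}
    (hq : q.Monic) {x y : Ω} (hx : aeval x q = 0) (hy : aeval y q = 0) [Normal K K⟮x⟯]
    (hdeg : Module.finrank K K⟮x⟯ = q.natDegree) : K⟮y⟯ = K⟮x⟯ := by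
  have hxi : IsIntegral K x := ⟨q, hq, hx⟩
  have hyi : IsIntegral K y := ⟨q, hq, hy⟩
  have hmin : q = minpoly K x := by
    refine (eq_of_monic_of_dvd_of_natDegree_le (minpoly.monic hxi) hq (minpoly.dvd K x hx) ?_)
    rw [← hdeg, adjoin.finrank hxi]
  have hminy : minpoly K y = minpoly K x :=
    (minpoly.eq_of_irreducible_of_monic (hmin ▸ minpoly.irreducible hxi) hy hq).symm.trans hmin
  have : FiniteDimensional K K⟮x⟯ := adjoin.finiteDimensional hxi
  have hmem : y ∈ K⟮x⟯ := by
    rw [← AlgHom.fieldRange_of_normal ((adjoin.powerBasis hxi).lift y (by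
      rw [adjoin.powerBasis_gen, minpoly_gen, ← hmin, hy]))]
    exact ⟨_, (adjoin.powerBasis hxi).lift_gen _ _⟩
  refine eq_of_le_of_finrank_eq (adjoin_simple_le_iff.mpr hmem) ?_
  rw [adjoin.finrank hxi, adjoin.finrank hyi, hminy]

/-- Let `K/ℚ_p` be finite unramified (`p` odd), `n = p²`, `c = 3`
(resp. `n = p³`, `c = 4`), and let `f, g` be Eisenstein polynomials of degree `n` over `K`
(given by their coefficient lists) such that the extension generated by a root of `f` is cyclic
of degree `n`.  If `v_p(f_i − g_i) ≥ c` for `1 ≤ i ≤ n−1` and `v_p(f_n − g_n) ≥ c+1`, then for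
every root `π` of `f` in a fixed algebraic closure of `K` there is a root `δ` of `g` with
`K(δ) = K(π)`; in particular the extension generated by `g` is also cyclic of degree `n`. -/
theorem stmt9 (p : ℕ) [Fact (Nat.Prime p)] (hodd : Odd p)
    (K : Type) [Field K] [Algebra ℚ_[p] K] [FiniteDimensional ℚ_[p] K]
    (hKloc : ∀ x : integralClosure ℤ_[p] K, ¬IsUnit x → (p : integralClosure ℤ_[p] K) ∣ x)
    (hKp : ¬IsUnit (p : integralClosure ℤ_[p] K))
    (n c : ℕ) (hnc : (n = p ^ 2 ∧ c = 3) ∨ (n = p ^ 3 ∧ c = 4))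
    (f g : ℕ → integralClosure ℤ_[p] K)
    -- `f` and `g` are Eisenstein of degree `n`
    (hfE : ∀ i, 1 ≤ i → i ≤ n → (p : integralClosure ℤ_[p] K) ∣ f i)
    (hfE' : ¬(p : integralClosure ℤ_[p] K) ^ 2 ∣ f n)
    (hgE : ∀ i, 1 ≤ i → i ≤ n → (p : integralClosure ℤ_[p] K) ∣ g i)
    (hgE' : ¬(p : integralClosure ℤ_[p] K) ^ 2 ∣ g n)
    -- the fixed algebraic closure
    (Ω : Type) [Field Ω] [Algebra K Ω] [IsAlgClosure K Ω]
    -- the extension generated by a root of `f` is cyclic of degree `n`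
    (hcyc : ∃ π₀ : Ω,
      aeval π₀ (X ^ n + ∑ i ∈ Finset.range n, C ((f (i + 1) : K)) * X ^ (n - (i + 1))) = 0 ∧
      IsGalois K (adjoin K {π₀}) ∧ IsCyclic (adjoin K {π₀} ≃ₐ[K] adjoin K {π₀}) ∧
      Module.finrank K (adjoin K {π₀}) = n)
    -- the congruence conditions on the coefficients
    (hcong : ∀ i, 1 ≤ i → i ≤ n - 1 → (p : integralClosure ℤ_[p] K) ^ c ∣ (f i - g i))
    (hcongn : (p : integralClosure ℤ_[p] K) ^ (c + 1) ∣ (f n - g n)) :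
    ∀ π : Ω,
      aeval π (X ^ n + ∑ i ∈ Finset.range n, C ((f (i + 1) : K)) * X ^ (n - (i + 1))) = 0 →
      ∃ δ : Ω,
        aeval δ (X ^ n + ∑ i ∈ Finset.range n, C ((g (i + 1) : K)) * X ^ (n - (i + 1))) = 0 ∧
        adjoin K {δ} = adjoin K {π} ∧
        IsGalois K (adjoin K {δ}) ∧ IsCyclic (adjoin K {δ} ≃ₐ[K] adjoin K {δ}) ∧
        Module.finrank K (adjoin K {δ}) = n := by
  have hp : p.Prime := Fact.out
  have hp3 : 3 ≤ p := by
    have := hp.two_le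
    have : p ≠ 2 := by rintro rfl; exact absurd hodd (by decide)
    omega
  obtain ⟨m, hn, hc⟩ : ∃ m, n = p ^ m ∧ c = m + 1 := by
    rcases hnc with ⟨h1, h2⟩ | ⟨h1, h2⟩
    exacts [⟨2, h1, h2⟩, ⟨3, h1, h2⟩]
  subst hc
  have hn1 : 1 ≤ n := hn ▸ Nat.one_le_pow _ _ hp.pos
  have : Algebra.IsAlgebraic K Ω := IsAlgClosure.isAlgebraic
  have : CharZero K := charZero_of_injective_algebraMap (algebraMap ℚ_[p] K).injective
  obtain ⟨v, hv, hinv, hvp, hint⟩ := exists_absoluteValue p K Ω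
  have hvp1 : v (p : Ω) < 1 := by
    rw [hvp]; exact inv_lt_one_of_one_lt₀ (by exact_mod_cast hp.one_lt)
  set w : AbsoluteValue K ℝ := v.comp (algebraMap K Ω).injective with hw
  have hwp : w (p : K) = v (p : Ω) := congrArg v (map_natCast (algebraMap K Ω) p)
  have hwint : ∀ x : K, IsIntegral ℤ_[p] x ↔ w x ≤ 1 := hint
  intro π hπ
  obtain ⟨π₀, hπ₀, hgal, hcyclic, hdeg⟩ := hcyc
  have hE : K⟮π⟯ = K⟮π₀⟯ :=
    adjoin_eq_of_aeval_eq_zero (monicOfCoeffs_monic n fun i => (f i : K)) hπ₀ hπ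
      (hdeg.trans (natDegree_monicOfCoeffs n _).symm)
  have htransfer : ∀ E : IntermediateField K Ω, E = K⟮π₀⟯ →
      IsGalois K E ∧ IsCyclic (E ≃ₐ[K] E) ∧ Module.finrank K E = n := by
    rintro _ rfl
    exact ⟨hgal, hcyclic, hdeg⟩
  obtain ⟨hgal', hcyclic', hdeg'⟩ := htransfer _ hE
  obtain ⟨δ, hδ, hδπ⟩ := exists_root_adjoin_eq (m := m) (f := fun i => (f i : K))
    (g := fun i => (g i : K)) hv hinv hp3 hvp1
    (fun a ha => hwp ▸ exists_apply_eq_zpow p K hKloc w (hwp ▸ hvp1) hwint ha) hn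
    (fun i h1 h2 =>
      (apply_le_pow_of_dvd hwint (k := 1) (by simpa using hfE i h1 h2)).trans_eq
        (by rw [pow_one, hwp]))
    (hwp ▸ apply_eq_of_dvd_of_not_sq_dvd hKloc hwint (hfE n hn1 le_rfl) hfE')
    (fun i h1 h2 =>
      (apply_le_pow_of_dvd hwint (k := 1) (by simpa using hgE i h1 h2)).trans_eq
        (by rw [pow_one, hwp]))
    (hwp ▸ apply_eq_of_dvd_of_not_sq_dvd hKloc hwint (hgE n hn1 le_rfl) hgE')
    (fun i h1 h2 => hwp ▸ apply_le_pow_of_dvd hwint (hcong i h1 h2))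
    (hwp ▸ apply_le_pow_of_dvd hwint hcongn) hπ hdeg'
  exact ⟨δ, hδ, hδπ, htransfer _ (hδπ.trans hE)⟩
end
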